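/- Holomorphy of the archimedean transform: Fix η > 40, H ∈ C_η, α = (α₁, α₂, α₃) ∈ ℂ³ with Re α_i = 0 and α₁ + α₂ + α₃ = 0, δ ∈ {+1, −1}, and φ ∈ (0, π/2]. Then the double integral defining (F_α^{(δ)} H)(s₀, s; φ) converges absolutely for every (s₀, s) in the open set Ω := {(s₀, s) ∈ ℂ² : Re s₀ > 1/100, Re s < 4, 2·Re s − Re s₀ − 1/100 > 0}, and the resulting function (s₀, s) ↦ (F_α^{(δ)} H)(s₀, s; φ) is holomorphic (jointly analytic) on Ω. -/

import Mathlib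

open Complex MeasureTheory Set

/-- `Γ_ℝ(s) := π^{−s/2} Γ(s/2)`. -/
noncomputable def GammaR (s : ℂ) : ℂ := (Real.pi : ℂ) ^ (-s / 2) * Complex.Gamma (s / 2)

/-- The K-Bessel function `K_μ(x) = ∫₀^∞ exp(−x cosh t) cosh(μt) dt`. -/
noncomputable def KBessel (μ : ℂ) (x : ℝ) : ℂ :=
  ∫ t in Ioi (0:ℝ), Complex.exp (-(x : ℂ) * (Real.cosh t : ℂ)) * Complex.cosh (μ * (t : ℂ))

/-- The GL(2) Whittaker function `W_μ(y) = 2√y K_μ(2πy)`. -/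
noncomputable def W2 (μ : ℂ) (y : ℝ) : ℂ :=
  2 * (Real.sqrt y : ℂ) * KBessel μ (2 * Real.pi * y)

/-- The class `C_η` of test functions. -/
def MemCeta (η : ℝ) (H : ℂ → ℂ) : Prop :=
  DifferentiableOn ℂ H {μ : ℂ | |μ.re| < 2 * η} ∧
  (∀ μ : ℂ, |μ.re| < 2 * η → H (-μ) = H μ) ∧
  ∃ C : ℝ, ∀ μ : ℂ, |μ.re| < 2 * η → ‖H μ‖ ≤ C * Real.exp (-2 * Real.pi * |μ.im|)

/-- The inverse Kontorovich–Lebedev transform. -/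
noncomputable def Hflat (H : ℂ → ℂ) (y : ℝ) : ℂ :=
  (1 / (4 * (Real.pi : ℂ))) * ∫ t : ℝ,
    H (t * I) * W2 (t * I) y / (Complex.Gamma (t * I) * Complex.Gamma (-(t * I)))

/-- Mellin transform `ĥ(w) := ∫₀^∞ h(y) y^{w−1} dy`. -/
noncomputable def mellinT (h : ℝ → ℂ) (w : ℂ) : ℂ :=
  ∫ y in Ioi (0:ℝ), h y * (y : ℂ) ^ (w - 1)

/-- The Mellin kernel `G_α(s₀,s₁)` of the GL(3) Whittaker function. -/
noncomputable def Gfun (α : Fin 3 → ℂ) (s0 s1 : ℂ) : ℂ :=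
  (∏ i, GammaR (s0 + α i) * GammaR (s1 - α i)) / GammaR (s0 + s1)

/-- The Gamma-kernel `𝒢_α^{(δ)}(s₁, u; s₀, s; φ)` of the archimedean transform. -/
noncomputable def GkerPhi (α : Fin 3 → ℂ) (δ φ : ℝ) (s1 u s0 s : ℂ) : ℂ :=
  Gfun α (s0 - u) s1 * (2 * (Real.pi : ℂ)) ^ (-u) *
    Complex.exp (Complex.I * δ * φ * u) * Complex.Gamma u *
    Complex.Gamma ((u + 1 - 2 * s + s1 - s0) / 2) *
    Complex.Gamma ((2 * s - s0 - u) / 2) / Complex.Gamma ((1 + s1) / 2 - s0)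

/-- The archimedean transform `(F_α^{(δ)} H)(s₀, s; φ)`, a double integral over
`s₁ = 15 + it₁` and `u = 1/100 + iv`. -/
noncomputable def FtransPhi (α : Fin 3 → ℂ) (δ φ : ℝ) (H : ℂ → ℂ) (s0 s : ℂ) : ℂ :=
  (1 / (2 * (Real.pi : ℂ))) ^ 2 *
    ∫ t1 : ℝ, ∫ v : ℝ,
      mellinT (Hflat H) (s - (15 + t1 * Complex.I) - 1/2) *
        GkerPhi α δ φ (15 + t1 * Complex.I) (1/100 + v * Complex.I) s0 s

/-! ### Vertical decay of the Gamma function -/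

/-- Comparison of `Γ` on two vertical lines, from the Beta integral. -/
lemma norm_Gamma_mul_Gamma_le {a : ℂ} (ha : 0 < a.re) {b : ℝ} (hb : 0 < b) :
    ‖Gamma a‖ * Real.Gamma (a.re + b) ≤ ‖Gamma (a + b)‖ * Real.Gamma a.re := by
  have hab : 0 < a.re + b := by positivity
  have hΓb := Real.Gamma_pos_of_pos hb
  have key := Gamma_mul_Gamma_eq_betaIntegral ha (by simpa using hb : 0 < (b : ℂ).re)
  have keyR := Gamma_mul_Gamma_eq_betaIntegral (s := (a.re : ℂ)) (t := (b : ℂ))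
    (by simpa using ha) (by simpa using hb)
  have hbeta : ‖betaIntegral a b‖ ≤ ‖betaIntegral (a.re : ℂ) b‖ := by
    set J : ℝ := ∫ x : ℝ in (0 : ℝ)..1, x ^ (a.re - 1) * (1 - x) ^ (b - 1) with hJ
    have hR : betaIntegral (a.re : ℂ) b = (J : ℂ) := by
      rw [betaIntegral, hJ, ← intervalIntegral.integral_ofReal]
      refine intervalIntegral.integral_congr fun x hx => ?_
      rw [uIcc_of_le zero_le_one] at hx
      have h1 : (0 : ℝ) ≤ 1 - x := by linarith [hx.2]
      simp only [ofReal_mul]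
      rw [ofReal_cpow hx.1, ofReal_cpow h1]
      push_cast
      rfl
    rw [hR]
    refine le_trans ?_ ((le_abs_self J).trans_eq (Complex.norm_real J).symm)
    refine (intervalIntegral.norm_integral_le_integral_norm zero_le_one).trans (le_of_eq ?_)
    rw [hJ, intervalIntegral.integral_of_le zero_le_one,
      intervalIntegral.integral_of_le zero_le_one, integral_Ioc_eq_integral_Ioo,
      integral_Ioc_eq_integral_Ioo]
    refine setIntegral_congr_fun measurableSet_Ioo fun x hx => ?_
    have h1 : (0 : ℝ) < 1 - x := by linarith [hx.2]
    have h2 : (1 - (x : ℂ)) = ((1 - x : ℝ) : ℂ) := by push_cast; rfl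
    simp only [norm_mul]
    rw [h2, norm_cpow_eq_rpow_re_of_pos hx.1, norm_cpow_eq_rpow_re_of_pos h1]
    simp
  rw [Gamma_ofReal, Gamma_ofReal, ← ofReal_add, Gamma_ofReal] at keyR
  have e1 : ‖Gamma a‖ * Real.Gamma b = ‖Gamma (a + b)‖ * ‖betaIntegral a b‖ := by
    rw [← norm_mul, ← key, norm_mul, Gamma_ofReal, norm_real, Real.norm_of_nonneg hΓb.le]
  have e2 : Real.Gamma a.re * Real.Gamma b =
      Real.Gamma (a.re + b) * ‖betaIntegral (a.re : ℂ) b‖ := by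
    have := congrArg norm keyR
    simpa only [norm_mul, norm_real, Real.norm_of_nonneg hΓb.le,
      Real.norm_of_nonneg (Real.Gamma_pos_of_pos ha).le,
      Real.norm_of_nonneg (Real.Gamma_pos_of_pos hab).le] using this
  have hΓab := Real.Gamma_pos_of_pos hab
  refine le_of_mul_le_mul_right ?_ hΓb
  calc ‖Gamma a‖ * Real.Gamma (a.re + b) * Real.Gamma b
      = ‖Gamma (a + b)‖ * Real.Gamma (a.re + b) * ‖betaIntegral a b‖ := by
        rw [mul_right_comm, e1]; ring
    _ ≤ ‖Gamma (a + b)‖ * Real.Gamma (a.re + b) * ‖betaIntegral (a.re : ℂ) b‖ := by gcongr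
    _ = _ := by rw [mul_assoc, ← e2]; ring

lemma norm_Gamma_half_sq (t : ℝ) :
    ‖Gamma (1 / 2 + t * I)‖ ^ 2 = Real.pi / Real.cosh (Real.pi * t) := by
  have h := Complex.Gamma_mul_Gamma_one_sub (1 / 2 + t * I)
  have hc : (1 : ℂ) - (1 / 2 + t * I) = (starRingEnd ℂ) (1 / 2 + t * I) := by
    apply Complex.ext <;> simp
    norm_num
  have hs : Complex.sin (Real.pi * (1 / 2 + t * I)) = (Real.cosh (Real.pi * t) : ℂ) := by
    rw [show (Real.pi : ℂ) * (1 / 2 + t * I) = (Real.pi * t : ℂ) * I + Real.pi / 2 by ring,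
      Complex.sin_add_pi_div_two, Complex.cos_mul_I]
    push_cast
    rfl
  rw [hc, Gamma_conj, Complex.mul_conj, Complex.normSq_eq_norm_sq, hs] at h
  exact_mod_cast h

lemma exists_add_abs_le_mul_exp {ε : ℝ} (hε : 0 < ε) (A : ℝ) :
    ∃ C > 0, ∀ t : ℝ, A + |t| ≤ C * Real.exp (ε * |t|) := by
  refine ⟨|A| + ε⁻¹, by positivity, fun t => ?_⟩
  have h1 : 1 ≤ Real.exp (ε * |t|) := Real.one_le_exp (by positivity)
  have h2 : ε * |t| ≤ Real.exp (ε * |t|) := by linarith [Real.add_one_le_exp (ε * |t|)]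
  have h3 : |t| ≤ ε⁻¹ * Real.exp (ε * |t|) := by
    rw [inv_mul_eq_div, le_div_iff₀ hε]; linarith
  nlinarith [le_abs_self A, abs_nonneg A]

lemma exists_norm_Gamma_nat_add_half_le (n : ℕ) {θ : ℝ} (hθ : θ < Real.pi / 2) :
    ∃ C > 0, ∀ t : ℝ, ‖Gamma (n + 1 / 2 + t * I)‖ ≤ C * Real.exp (-θ * |t|) := by
  induction n generalizing θ with
  | zero =>
    refine ⟨Real.sqrt (2 * Real.pi), by positivity, fun t => ?_⟩
    rw [Nat.cast_zero, zero_add]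
    refine abs_le_of_sq_le_sq' ?_ (by positivity) |>.2
    rw [norm_Gamma_half_sq, mul_pow, Real.sq_sqrt (by positivity), ← Real.exp_nat_mul,
      div_le_iff₀ (Real.cosh_pos _)]
    have h1 : Real.exp (Real.pi * |t|) / 2 ≤ Real.cosh (Real.pi * t) := by
      rw [← Real.cosh_abs, abs_mul, abs_of_pos Real.pi_pos, Real.cosh_eq]
      have := Real.exp_pos (-(Real.pi * |t|))
      linarith
    have h2 : 1 ≤ Real.exp ((2 : ℕ) * (-θ * |t|)) * Real.exp (Real.pi * |t|) := by
      rw [← Real.exp_add]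
      apply Real.one_le_exp
      push_cast
      nlinarith [abs_nonneg t]
    have h3 := Real.exp_pos ((2 : ℕ) * (-θ * |t|))
    set E := Real.exp ((2 : ℕ) * (-θ * |t|))
    calc Real.pi ≤ Real.pi * (E * Real.exp (Real.pi * |t|)) :=
          le_mul_of_one_le_right Real.pi_pos.le h2
      _ = 2 * Real.pi * E * (Real.exp (Real.pi * |t|) / 2) := by ring
      _ ≤ 2 * Real.pi * E * Real.cosh (Real.pi * t) := by gcongr
  | succ n ih =>
    obtain ⟨θ', h1, h2⟩ := exists_between hθ
    obtain ⟨C, hC, hb⟩ := ih h2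
    obtain ⟨D, hD, hd⟩ := exists_add_abs_le_mul_exp (sub_pos.2 h1) (n + 1 / 2)
    refine ⟨D * C, by positivity, fun t => ?_⟩
    have hz : (n + 1 / 2 + t * I : ℂ) ≠ 0 := by
      intro h
      have := congrArg Complex.re h
      simp at this
      linarith [(Nat.cast_nonneg n : (0 : ℝ) ≤ n)]
    have e : ((n + 1 : ℕ) + 1 / 2 + t * I : ℂ) = (n + 1 / 2 + t * I) + 1 := by push_cast; ring
    rw [e, Gamma_add_one _ hz, norm_mul]
    have hn : ‖(n + 1 / 2 + t * I : ℂ)‖ ≤ (n + 1 / 2) + |t| := by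
      refine (norm_add_le _ _).trans (add_le_add (le_of_eq ?_) (le_of_eq ?_))
      · rw [show (n + 1 / 2 : ℂ) = ((n + 1 / 2 : ℝ) : ℂ) by push_cast; rfl, norm_real,
          Real.norm_of_nonneg (by positivity)]
      · simp
    calc _ ≤ (D * Real.exp ((θ' - θ) * |t|)) * (C * Real.exp (-θ' * |t|)) :=
          mul_le_mul (hn.trans (hd t)) (hb t) (norm_nonneg _) (by positivity)
      _ = D * C * (Real.exp ((θ' - θ) * |t|) * Real.exp (-θ' * |t|)) := by ring
      _ = _ := by rw [← Real.exp_add]; ring_nf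

lemma continuousOn_Gamma_Ioi : ContinuousOn Real.Gamma (Ioi 0) := by
  intro x (hx : 0 < x)
  refine (Real.differentiableAt_Gamma fun m h => ?_).continuousAt.continuousWithinAt
  linarith [(Nat.cast_nonneg m : (0 : ℝ) ≤ m)]

/-- Uniform exponential decay of `Γ` on vertical strips to the right of `0`. -/
lemma exists_norm_Gamma_le {θ : ℝ} (hθ : θ < Real.pi / 2) {a : ℝ} (ha : 0 < a) (b : ℝ) :
    ∃ C > 0, ∀ s : ℂ, a ≤ s.re → s.re ≤ b → ‖Gamma s‖ ≤ C * Real.exp (-θ * |s.im|) := by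
  obtain ⟨n, hn⟩ := exists_nat_ge b
  obtain ⟨C, hC, hb⟩ := exists_norm_Gamma_nat_add_half_le n hθ
  obtain ⟨D, hD⟩ := isCompact_Icc.exists_bound_of_continuousOn
    (continuousOn_Gamma_Ioi.mono fun x (hx : x ∈ Icc a b) => ha.trans_le hx.1)
  have hG : 0 < Real.Gamma (n + 1 / 2) := Real.Gamma_pos_of_pos (by positivity)
  refine ⟨C * (|D| + 1) / Real.Gamma (n + 1 / 2), by positivity, fun s h1 h2 => ?_⟩
  have hpos : 0 < n + 1 / 2 - s.re := by linarith
  have h := norm_Gamma_mul_Gamma_le (ha.trans_le h1) hpos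
  have e : s + ((n + 1 / 2 - s.re : ℝ) : ℂ) = n + 1 / 2 + s.im * I := by
    conv_lhs => rw [← re_add_im s]
    push_cast
    simp only [add_re, ofReal_re, mul_re, I_re, mul_zero, ofReal_im, I_im, mul_one, sub_self,
      add_zero]
    ring
  rw [e, add_sub_cancel] at h
  have hGs : Real.Gamma s.re ≤ |D| + 1 := by
    have := hD s.re ⟨h1, h2⟩
    rw [Real.norm_eq_abs] at this
    linarith [le_abs_self (Real.Gamma s.re), le_abs_self D]
  rw [div_mul_eq_mul_div, le_div_iff₀ hG]
  calc _ ≤ _ := h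
    _ ≤ (C * Real.exp (-θ * |s.im|)) * (|D| + 1) :=
      mul_le_mul (hb _) hGs (Real.Gamma_pos_of_pos (ha.trans_le h1)).le (by positivity)
    _ = _ := by ring

lemma inv_norm_Gamma_le {s : ℂ} (hs : 1 / 2 < s.re) :
    ‖Gamma s‖⁻¹ ≤ Real.exp (Real.pi / 2 * |s.im|) / Real.Gamma s.re := by
  have hpos : 0 < s.re - 1 / 2 := by linarith
  have h := norm_Gamma_mul_Gamma_le (a := 1 / 2 + s.im * I) (by simp) hpos
  have e : (1 / 2 + s.im * I : ℂ) + ((s.re - 1 / 2 : ℝ) : ℂ) = s := by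
    conv_rhs => rw [← re_add_im s]
    push_cast
    ring
  have e2 : (1 / 2 + s.im * I : ℂ).re = 1 / 2 := by simp
  rw [e, e2, add_sub_cancel, Real.Gamma_one_half_eq] at h
  have hG : 0 < Real.Gamma s.re := Real.Gamma_pos_of_pos (by linarith)
  have hΓ : 0 < ‖Gamma s‖ := norm_pos_iff.2 (Gamma_ne_zero_of_re_pos (by linarith))
  have hlow : Real.sqrt Real.pi ≤ Real.exp (Real.pi / 2 * |s.im|) * ‖Gamma (1 / 2 + s.im * I)‖ := by
    refine abs_le_of_sq_le_sq' ?_ (by positivity) |>.2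
    rw [mul_pow, norm_Gamma_half_sq, Real.sq_sqrt Real.pi_pos.le, ← mul_div_assoc,
      le_div_iff₀ (Real.cosh_pos _), mul_comm, ← Real.exp_nat_mul]
    have : Real.cosh (Real.pi * s.im) ≤ Real.exp (Real.pi * |s.im|) := by
      rw [← Real.cosh_abs, abs_mul, abs_of_pos Real.pi_pos, Real.cosh_eq]
      have : Real.exp (-(Real.pi * |s.im|)) ≤ Real.exp (Real.pi * |s.im|) :=
        Real.exp_le_exp.2 (neg_le_self (by positivity))
      linarith
    rw [show ((2 : ℕ) : ℝ) * (Real.pi / 2 * |s.im|) = Real.pi * |s.im| by push_cast; ring]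
    gcongr
  rw [inv_eq_one_div, div_le_div_iff₀ hΓ hG, one_mul]
  have hπ : 0 < Real.sqrt Real.pi := by positivity
  refine le_of_mul_le_mul_right ?_ hπ
  calc Real.Gamma s.re * Real.sqrt Real.pi
      ≤ Real.Gamma s.re * (Real.exp (Real.pi / 2 * |s.im|) * ‖Gamma (1 / 2 + s.im * I)‖) := by
        gcongr
    _ = Real.exp (Real.pi / 2 * |s.im|) * (‖Gamma (1 / 2 + s.im * I)‖ * Real.Gamma s.re) := by ring
    _ ≤ Real.exp (Real.pi / 2 * |s.im|) * (‖Gamma s‖ * Real.sqrt Real.pi) := by gcongr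
    _ = _ := by ring

/-- Uniform exponential growth of `1 / Γ` on vertical strips to the right of `0`. -/
lemma exists_inv_norm_Gamma_le {θ : ℝ} (hθ : Real.pi / 2 < θ) {a : ℝ} (ha : 0 < a) (b : ℝ) :
    ∃ C > 0, ∀ s : ℂ, a ≤ s.re → s.re ≤ b → ‖Gamma s‖⁻¹ ≤ C * Real.exp (θ * |s.im|) := by
  obtain ⟨D, hD⟩ := isCompact_Icc.exists_bound_of_continuousOn
    (f := fun x => (Real.Gamma (x + 1))⁻¹) (s := Icc a b) (by
      refine ContinuousOn.inv₀ (continuousOn_Gamma_Ioi.comp (by fun_prop) ?_) ?_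
      · intro x hx
        have : 0 < x + 1 := by linarith [hx.1]
        exact this
      · intro x hx
        exact (Real.Gamma_pos_of_pos (by linarith [hx.1])).ne')
  obtain ⟨E, hE, he⟩ := exists_add_abs_le_mul_exp (sub_pos.2 hθ) (|b|)
  refine ⟨E * (|D| + 1), by positivity, fun s h1 h2 => ?_⟩
  have hs : s ≠ 0 := fun h => by simp [h] at h1; linarith
  have hn : ‖s‖ ≤ |b| + |s.im| := by
    refine (norm_le_abs_re_add_abs_im s).trans (add_le_add_left ?_ _)
    rw [abs_of_pos (ha.trans_le h1)]
    exact h2.trans (le_abs_self b)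
  have h := inv_norm_Gamma_le (s := s + 1) (by simp; linarith)
  simp only [add_re, one_re, add_im, one_im, add_zero] at h
  rw [Gamma_add_one _ hs, norm_mul] at h
  have hG : (Real.Gamma (s.re + 1))⁻¹ ≤ |D| + 1 := by
    have := (le_abs_self _).trans (hD s.re ⟨h1, h2⟩)
    linarith [le_abs_self D]
  have hs' : 0 < ‖s‖ := norm_pos_iff.2 hs
  calc ‖Gamma s‖⁻¹ = ‖s‖ * (‖s‖ * ‖Gamma s‖)⁻¹ := by
        rw [mul_inv, mul_inv_cancel_left₀ hs'.ne']
    _ ≤ (E * Real.exp ((θ - Real.pi / 2) * |s.im|)) *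
          (Real.exp (Real.pi / 2 * |s.im|) * (|D| + 1)) := by
        refine mul_le_mul (hn.trans (he _)) (h.trans ?_) (by positivity) (by positivity)
        rw [div_eq_mul_inv]
        gcongr
    _ = E * (|D| + 1) *
          (Real.exp ((θ - Real.pi / 2) * |s.im|) * Real.exp (Real.pi / 2 * |s.im|)) := by ring
    _ = _ := by rw [← Real.exp_add]; ring_nf

/-! ### Fourier transforms of holomorphic functions on vertical strips -/

lemma integrable_exp_neg_mul_abs {c : ℝ} (hc : 0 < c) :
    Integrable fun t : ℝ => Real.exp (-c * |t|) := by
  rw [← integrableOn_univ, ← Iic_union_Ioi (a := (0 : ℝ))]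
  refine IntegrableOn.union ?_ ?_
  · refine (integrableOn_exp_mul_Iic hc 0).congr_fun (fun t ht => ?_) measurableSet_Iic
    simp only [abs_of_nonpos (show t ≤ 0 from ht)]
    ring_nf
  · refine (integrableOn_exp_mul_Ioi (neg_lt_zero.2 hc) 0).congr_fun (fun t ht => ?_)
      measurableSet_Ioi
    simp only [abs_of_pos (show 0 < t from ht)]

lemma integral_eq_two_mul_integral_Ioi_of_even {f : ℝ → ℂ} (hf : Integrable f)
    (heven : ∀ x, f (-x) = f x) : ∫ x, f x = 2 * ∫ x in Ioi (0 : ℝ), f x := by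
  rw [← intervalIntegral.integral_Iic_add_Ioi (b := 0) hf.integrableOn hf.integrableOn, two_mul]
  congr 1
  have := integral_comp_neg_Ioi (0 : ℝ) f
  simp only [heven, neg_zero] at this
  exact this.symm

/-- `F` is holomorphic and `O(exp (-|Im z|))` on the closed vertical strip `|Re z| ≤ B`. -/
structure StripDecay (B C : ℝ) (F : ℂ → ℂ) : Prop where
  diff : DifferentiableOn ℂ F {z | |z.re| ≤ B}
  bound : ∀ z : ℂ, |z.re| ≤ B → ‖F z‖ ≤ C * Real.exp (-|z.im|)

namespace StripDecay

variable {B C : ℝ} {F : ℂ → ℂ}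

lemma continuous_line (hF : StripDecay B C F) {k : ℝ} (hk : |k| ≤ B) :
    Continuous fun t : ℝ => F (k + t * I) :=
  hF.diff.continuousOn.comp_continuous (by fun_prop) fun t => by simpa using hk

lemma norm_line_le (hF : StripDecay B C F) {k : ℝ} (hk : |k| ≤ B) (t : ℝ) :
    ‖F (k + t * I)‖ ≤ C * Real.exp (-1 * |t|) := by
  simpa using hF.bound (k + t * I) (by simpa using hk)

lemma integrable_line (hF : StripDecay B C F) {k : ℝ} (hk : |k| ≤ B) :
    Integrable fun t : ℝ => F (k + t * I) :=
  ((integrable_exp_neg_mul_abs one_pos).const_mul C).mono'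
    (hF.continuous_line hk).aestronglyMeasurable (ae_of_all _ (hF.norm_line_le hk))

/-- Integrals over vertical lines inside the strip do not depend on the line. -/
lemma integral_line_eq (hF : StripDecay B C F) {a b : ℝ} (hab : a ≤ b) (ha : |a| ≤ B)
    (hb : |b| ≤ B) : ∫ t : ℝ, F (a + t * I) = ∫ t : ℝ, F (b + t * I) := by
  have hre : ∀ z : ℂ, a ≤ z.re → z.re ≤ b → |z.re| ≤ B := fun z h1 h2 =>
    abs_le.2 ⟨(abs_le.1 ha).1.trans h1, h2.trans (abs_le.1 hb).2⟩
  have hA := intervalIntegral_tendsto_integral (hF.integrable_line ha)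
    Filter.tendsto_neg_atTop_atBot Filter.tendsto_id
  have hB := intervalIntegral_tendsto_integral (hF.integrable_line hb)
    Filter.tendsto_neg_atTop_atBot Filter.tendsto_id
  have hexp : Filter.Tendsto (fun T : ℝ => C * Real.exp (-|T|) * |b - a|) Filter.atTop
      (nhds 0) := by
    have : Filter.Tendsto (fun T : ℝ => Real.exp (-|T|)) Filter.atTop (nhds 0) :=
      Real.tendsto_exp_neg_atTop_nhds_zero.comp Filter.tendsto_abs_atTop_atTop
    simpa using (this.const_mul C).mul_const |b - a|
  have hside : ∀ T : ℝ, ‖∫ x : ℝ in a..b, F (x + T * I)‖ ≤ C * Real.exp (-|T|) * |b - a| := by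
    intro T
    refine intervalIntegral.norm_integral_le_of_norm_le_const fun x hx => ?_
    rw [uIoc_of_le hab] at hx
    simpa using hF.bound (x + T * I) (hre _ (by simpa using hx.1.le) (by simpa using hx.2))
  have htop : Filter.Tendsto (fun T : ℝ => ∫ x : ℝ in a..b, F (x + T * I)) Filter.atTop (nhds 0) :=
    squeeze_zero_norm hside hexp
  have hbot : Filter.Tendsto (fun T : ℝ => ∫ x : ℝ in a..b, F (x + (-T : ℝ) * I))
      Filter.atTop (nhds 0) :=
    squeeze_zero_norm (fun T => by simpa only [abs_neg] using hside (-T)) hexp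
  have hrect : ∀ T : ℝ, (∫ x : ℝ in a..b, F (x + (-T : ℝ) * I)) - (∫ x : ℝ in a..b, F (x + T * I)) +
      I * (∫ y : ℝ in (-T)..T, F (b + y * I)) - I * (∫ y : ℝ in (-T)..T, F (a + y * I)) = 0 := by
    intro T
    have := integral_boundary_rect_eq_zero_of_differentiableOn F (a + (-T : ℝ) * I) (b + T * I)
      (hF.diff.mono fun z hz => by
        have h := hz.1
        simp only [add_re, ofReal_re, mul_re, I_re, mul_zero, ofReal_im, I_im, mul_one, sub_self,
          add_zero, mem_preimage, uIcc_of_le hab] at h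
        exact hre z h.1 h.2)
    simpa using this
  have hlim := ((hbot.sub htop).add (hB.const_mul I)).sub (hA.const_mul I)
  have hz := tendsto_nhds_unique (hlim.congr hrect) tendsto_const_nhds
  rw [sub_zero, zero_add, ← mul_sub] at hz
  exact (sub_eq_zero.1 ((mul_eq_zero.1 hz).resolve_left I_ne_zero)).symm

lemma mul_exp (hF : StripDecay B C F) (r : ℝ) :
    StripDecay B (C * Real.exp (B * |r|)) fun z => F z * cexp (z * r) where
  diff := hF.diff.mul (by fun_prop)
  bound z hz := by
    rw [norm_mul, norm_exp]
    have h1 : (z * r).re ≤ B * |r| := by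
      rw [re_mul_ofReal]
      calc z.re * r ≤ |z.re * r| := le_abs_self _
        _ = |z.re| * |r| := abs_mul _ _
        _ ≤ _ := by gcongr
    calc _ ≤ (C * Real.exp (-|z.im|)) * Real.exp (B * |r|) := by
          refine mul_le_mul (hF.bound z hz) (Real.exp_le_exp.2 h1) (by positivity)
            ((norm_nonneg _).trans (hF.bound z hz))
      _ = _ := by ring

end StripDecay

/-- The Fourier transform of `F` along the imaginary axis. -/
noncomputable def axisFourier (F : ℂ → ℂ) (r : ℝ) : ℂ := ∫ t : ℝ, F (t * I) * cexp (t * I * r)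

namespace StripDecay

variable {B C : ℝ} {F : ℂ → ℂ}

lemma axisFourier_eq (hF : StripDecay B C F) {k : ℝ} (hk : |k| ≤ B) (r : ℝ) :
    axisFourier F r = cexp (k * r) * ∫ t : ℝ, F (k + t * I) * cexp (t * I * r) := by
  have hB : |(0 : ℝ)| ≤ B := by simpa using (abs_nonneg k).trans hk
  have key : axisFourier F r = ∫ t : ℝ, F (k + t * I) * cexp ((k + t * I) * r) := by
    have e : axisFourier F r = ∫ t : ℝ, F ((0 : ℝ) + t * I) * cexp (((0 : ℝ) + t * I) * r) := by
      simp [axisFourier]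
    rw [e]
    rcases le_total 0 k with h | h
    · exact (hF.mul_exp r).integral_line_eq h hB hk
    · exact ((hF.mul_exp r).integral_line_eq h hk hB).symm
  rw [key, ← integral_const_mul]
  congr 1 with t
  rw [add_mul, Complex.exp_add]
  ring

lemma norm_axisFourier_le (hF : StripDecay B C F) (hB : 0 ≤ B) (r : ℝ) :
    ‖axisFourier F r‖ ≤ (C * ∫ t : ℝ, Real.exp (-1 * |t|)) * Real.exp (-B * |r|) := by
  have main : ∀ k : ℝ, |k| ≤ B →
      ‖axisFourier F r‖ ≤ Real.exp (k * r) * (C * ∫ t : ℝ, Real.exp (-1 * |t|)) := by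
    intro k hk
    rw [hF.axisFourier_eq hk, norm_mul, norm_exp]
    have e : ((k : ℂ) * r).re = k * r := by simp
    rw [e, ← integral_const_mul]
    gcongr
    refine norm_integral_le_of_norm_le ((integrable_exp_neg_mul_abs one_pos).const_mul C)
      (ae_of_all _ fun t => ?_)
    rw [norm_mul, norm_exp]
    simpa using hF.norm_line_le hk t
  rcases le_total 0 r with h | h
  · refine (main (-B) (by simp [abs_of_nonneg hB])).trans (le_of_eq ?_)
    rw [abs_of_nonneg h, mul_comm]
  · refine (main B (by simp [abs_of_nonneg hB])).trans (le_of_eq ?_)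
    rw [abs_of_nonpos h, mul_comm, neg_mul_neg]

lemma continuous_axisFourier (hF : StripDecay B C F) (hB : 0 ≤ B) :
    Continuous (axisFourier F) := by
  have h0 : |(0 : ℝ)| ≤ B := by simpa using hB
  have hc : Continuous fun t : ℝ => F (t * I) := by simpa using hF.continuous_line h0
  refine continuous_of_dominated (bound := fun t => C * Real.exp (-1 * |t|))
    (fun r => (hc.mul (by fun_prop)).aestronglyMeasurable) (fun r => ae_of_all _ fun t => ?_)
    ((integrable_exp_neg_mul_abs one_pos).const_mul C) (ae_of_all _ fun t => by fun_prop)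
  rw [norm_mul, norm_exp]
  simpa using hF.norm_line_le h0 t

lemma integrable_exp_mul_axisFourier (hF : StripDecay B C F) (hB : 0 ≤ B) {k : ℝ} (hk : |k| < B) :
    Integrable fun r : ℝ => Real.exp (k * r) * axisFourier F r := by
  have hcont := hF.continuous_axisFourier hB
  refine ((integrable_exp_neg_mul_abs (sub_pos.2 hk)).const_mul
    (C * ∫ t : ℝ, Real.exp (-1 * |t|))).mono' (by fun_prop) (ae_of_all _ fun r => ?_)
  have hCI := (norm_nonneg _).trans (hF.norm_axisFourier_le hB 0)
  simp only [abs_zero, mul_zero, Real.exp_zero, mul_one] at hCI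
  rw [norm_mul, norm_real, Real.norm_of_nonneg (Real.exp_pos _).le]
  have h1 : k * r ≤ |k| * |r| := (le_abs_self _).trans (abs_mul _ _).le
  calc _ ≤ Real.exp (|k| * |r|) *
        ((C * ∫ t : ℝ, Real.exp (-1 * |t|)) * Real.exp (-B * |r|)) :=
        mul_le_mul (Real.exp_le_exp.2 h1) (hF.norm_axisFourier_le hB r) (norm_nonneg _)
          (by positivity)
    _ = (C * ∫ t : ℝ, Real.exp (-1 * |t|)) *
        (Real.exp (|k| * |r|) * Real.exp (-B * |r|)) := by ring
    _ = _ := by rw [← Real.exp_add]; ring_nf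

/-- Exponential moments of the axis Fourier transform recover the values of `F`. -/
lemma integral_exp_mul_axisFourier (hF : StripDecay B C F) (hB : 0 ≤ B) {k : ℝ} (hk : |k| < B) :
    ∫ r : ℝ, (Real.exp (k * r) : ℂ) * axisFourier F r = 2 * Real.pi * F (-k) := by
  have hk' : |-k| ≤ B := by rw [abs_neg]; exact hk.le
  set f : ℝ → ℂ := fun t => F ((-k : ℝ) + t * I) with hf
  have hfour : ∀ r : ℝ, (Real.exp (k * r) : ℂ) * axisFourier F r =
      FourierTransform.fourier f (-(2 * Real.pi)⁻¹ * r) := by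
    intro r
    rw [hF.axisFourier_eq hk', Real.fourier_real_eq_integral_exp_smul, ← mul_assoc, ofReal_exp,
      ← Complex.exp_add]
    have : (((k * r : ℝ) : ℂ) + ((-k : ℝ) : ℂ) * r) = 0 := by push_cast; ring
    rw [this, Complex.exp_zero, one_mul]
    congr 1 with t
    rw [smul_eq_mul, mul_comm]
    congr 2
    have : (Real.pi : ℂ) ≠ 0 := ofReal_ne_zero.2 Real.pi_ne_zero
    push_cast
    field_simp
  have hint : Integrable (FourierTransform.fourier f) := by
    have h := hF.integrable_exp_mul_axisFourier hB hk
    simp only [hfour] at h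
    exact (integrable_comp_mul_left_iff _ (neg_ne_zero.2 (by positivity))).1 h
  have hinv := (hF.integrable_line hk').fourierInv_fourier_eq hint (v := 0)
    (hF.continuous_line hk').continuousAt
  rw [Real.fourierInv_eq'] at hinv
  simp only [inner_zero_right, mul_zero, ofReal_zero, zero_mul, Complex.exp_zero, one_smul,
    add_zero] at hinv
  simp only [hfour]
  rw [Measure.integral_comp_mul_left, hinv]
  simp [abs_of_pos Real.pi_pos]

end StripDecay

/-! ### The inverse Kontorovich–Lebedev transform -/

lemma inv_Gamma_mul_Gamma_neg (μ : ℂ) :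
    (Gamma μ * Gamma (-μ))⁻¹ = -(μ * Complex.sin (Real.pi * μ) / Real.pi) := by
  rcases eq_or_ne μ 0 with rfl | h
  · simp
  · have h1 := Complex.Gamma_mul_Gamma_one_sub μ
    rw [show (1 : ℂ) - μ = -μ + 1 by ring, Gamma_add_one _ (neg_ne_zero.2 h)] at h1
    have h2 : (Gamma μ * Gamma (-μ))⁻¹ = -μ * (Gamma μ * (-μ * Gamma (-μ)))⁻¹ := by
      rw [mul_left_comm (Gamma μ), mul_inv (-μ), mul_inv_cancel_left₀ (neg_ne_zero.2 h)]
    rw [h2, h1, inv_div]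
    ring

/-- The spectral density `H(μ) / (Γ(μ) Γ(-μ))`, written as a holomorphic function. -/
noncomputable def spectralDensity (H : ℂ → ℂ) (μ : ℂ) : ℂ :=
  -(H μ * (μ * Complex.sin (Real.pi * μ) / Real.pi))

lemma norm_sin_le_exp (z : ℂ) : ‖Complex.sin z‖ ≤ Real.exp |z.im| := by
  have h1 : ‖cexp (-z * I)‖ ≤ Real.exp |z.im| := by
    rw [norm_exp]
    exact Real.exp_le_exp.2 (by simpa using le_abs_self z.im)
  have h2 : ‖cexp (z * I)‖ ≤ Real.exp |z.im| := by
    rw [norm_exp]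
    exact Real.exp_le_exp.2 (by simpa using neg_le_abs z.im)
  rw [Complex.sin, norm_div, norm_mul, norm_I, mul_one, Complex.norm_ofNat, div_le_iff₀ two_pos]
  exact (norm_sub_le _ _).trans (by linarith)

lemma exists_stripDecay_spectralDensity {η : ℝ} {H : ℂ → ℂ} (hH : MemCeta η H) {B : ℝ}
    (hB : B < 2 * η) : ∃ C, StripDecay B C (spectralDensity H) := by
  obtain ⟨hd, -, C, hC⟩ := hH
  obtain ⟨E, hE, he⟩ := exists_add_abs_le_mul_exp
    (show (0 : ℝ) < Real.pi - 1 by linarith [Real.pi_gt_three]) B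
  refine ⟨|C| * E / Real.pi, ?_, fun z hz => ?_⟩
  · refine ((hd.mono fun z (hz : |z.re| ≤ B) => hz.trans_lt hB).mul ?_).neg
    fun_prop
  · have h1 : ‖H z‖ ≤ |C| * Real.exp (-2 * Real.pi * |z.im|) :=
      (hC z (hz.trans_lt hB)).trans (by gcongr; exact le_abs_self C)
    have h2 : ‖z‖ ≤ E * Real.exp ((Real.pi - 1) * |z.im|) :=
      ((norm_le_abs_re_add_abs_im z).trans (by gcongr)).trans (he z.im)
    have h3 : ‖Complex.sin (Real.pi * z)‖ ≤ Real.exp (Real.pi * |z.im|) := by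
      refine (norm_sin_le_exp _).trans (le_of_eq ?_)
      rw [im_ofReal_mul, abs_mul, abs_of_pos Real.pi_pos]
    rw [spectralDensity, norm_neg, norm_mul, norm_div, norm_mul, norm_real,
      Real.norm_of_nonneg Real.pi_pos.le]
    calc _ ≤ (|C| * Real.exp (-2 * Real.pi * |z.im|)) *
          ((E * Real.exp ((Real.pi - 1) * |z.im|)) * Real.exp (Real.pi * |z.im|) / Real.pi) := by
          gcongr
      _ = |C| * E / Real.pi * (Real.exp (-2 * Real.pi * |z.im|) *
          Real.exp ((Real.pi - 1) * |z.im|) * Real.exp (Real.pi * |z.im|)) := by ring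
      _ = _ := by rw [← Real.exp_add, ← Real.exp_add]; ring_nf

lemma spectralDensity_neg {H : ℂ → ℂ} {μ : ℂ} (h : H (-μ) = H μ) :
    spectralDensity H (-μ) = spectralDensity H μ := by
  simp [spectralDensity, h, Complex.sin_neg]

lemma spectralDensity_intCast (H : ℂ → ℂ) (k : ℤ) : spectralDensity H k = 0 := by
  have : Complex.sin (Real.pi * k) = 0 := by rw [mul_comm]; exact Complex.sin_int_mul_pi k
  simp [spectralDensity, this]

lemma integrable_exp_neg_mul_cosh {x : ℝ} (hx : 0 < x) :
    Integrable fun r : ℝ => Real.exp (-x * Real.cosh r) := by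
  refine (integrable_exp_neg_mul_abs hx).mono' (by fun_prop) (ae_of_all _ fun r => ?_)
  rw [Real.norm_of_nonneg (Real.exp_pos _).le]
  refine Real.exp_le_exp.2 ?_
  have h : |r| ≤ Real.cosh r := by
    have h₁ := Real.quadratic_le_exp_of_nonneg (abs_nonneg r)
    have h₂ := Real.add_one_le_exp (-|r|)
    rw [← Real.cosh_abs, Real.cosh_eq]
    nlinarith [sq_nonneg (|r| - 2)]
  nlinarith

lemma norm_cosh_mul_I_mul_le (t r : ℝ) : ‖Complex.cosh (t * I * r)‖ ≤ 1 := by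
  rw [show (t * I * r : ℂ) = ((t * r : ℝ) : ℂ) * I by push_cast; ring, Complex.cosh_mul_I,
    ← ofReal_cos, norm_real]
  exact Real.abs_cos_le_one _

lemma KBessel_mul_I_eq (t : ℝ) {x : ℝ} (hx : 0 < x) :
    2 * KBessel (t * I) x =
      ∫ r : ℝ, (Real.exp (-x * Real.cosh r) : ℂ) * Complex.cosh (t * I * r) := by
  rw [integral_eq_two_mul_integral_Ioi_of_even]
  · simp only [KBessel, ofReal_exp, ofReal_mul, ofReal_neg]
  · refine (integrable_exp_neg_mul_cosh hx).mono'
      (Continuous.aestronglyMeasurable (by fun_prop)) (ae_of_all _ fun r => ?_)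
    rw [norm_mul, norm_real, Real.norm_of_nonneg (Real.exp_pos _).le]
    exact mul_le_of_le_one_right (Real.exp_pos _).le (norm_cosh_mul_I_mul_le t r)
  · intro r
    rw [Real.cosh_neg, ofReal_neg, mul_neg, Complex.cosh_neg]

/-- For even `F`, the axis Fourier transform is a cosine transform. -/
lemma StripDecay.integral_mul_cosh {B C : ℝ} {F : ℂ → ℂ} (hF : StripDecay B C F) (hB : 0 ≤ B)
    (heven : ∀ t : ℝ, F (-(t * I)) = F (t * I)) (r : ℝ) :
    ∫ t : ℝ, F (t * I) * Complex.cosh (t * I * r) = axisFourier F r := by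
  have h0 : |(0 : ℝ)| ≤ B := by simpa using hB
  have hint : Integrable fun t : ℝ => F (t * I) * cexp (t * I * r) := by
    simpa using (hF.mul_exp r).integrable_line h0
  have hint' : Integrable fun t : ℝ => F (t * I) * cexp (-(t * I * r)) := by
    simpa using (hF.mul_exp (-r)).integrable_line h0
  have hsymm : ∫ t : ℝ, F (t * I) * cexp (-(t * I * r)) = axisFourier F r := by
    rw [axisFourier, ← integral_neg_eq_self]
    congr 1 with t
    rw [← heven t]
    push_cast
    ring_nf
  have e : ∀ t : ℝ, F (t * I) * Complex.cosh (t * I * r) =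
      2⁻¹ * (F (t * I) * cexp (t * I * r) + F (t * I) * cexp (-(t * I * r))) := by
    intro t
    rw [Complex.cosh]
    ring
  simp only [e]
  rw [integral_const_mul, integral_add hint hint', hsymm, ← axisFourier]
  ring

/-- `h(y) = (√y / 4π) ∫ exp(-2πy cosh r) g(r) dr` with `g` the axis Fourier transform of the
spectral density. -/
lemma Hflat_eq {η : ℝ} (hη : 40 < η) {H : ℂ → ℂ} (hH : MemCeta η H) {y : ℝ} (hy : 0 < y) :
    Hflat H y = (1 / (4 * (Real.pi : ℂ))) * (Real.sqrt y : ℂ) *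
      ∫ r : ℝ, (Real.exp (-(2 * Real.pi * y) * Real.cosh r) : ℂ) *
        axisFourier (spectralDensity H) r := by
  obtain ⟨C, hF⟩ := exists_stripDecay_spectralDensity hH (show 0 < 2 * η by linarith)
  have hx : 0 < 2 * Real.pi * y := by positivity
  set x := 2 * Real.pi * y
  set F := spectralDensity H with hFdef
  have heven : ∀ t : ℝ, F (-(t * I)) = F (t * I) := fun t =>
    spectralDensity_neg (hH.2.1 _ (by simp; linarith))
  have hFc : Continuous fun t : ℝ => F (t * I) := by
    simpa using hF.continuous_line (k := 0) (by simp)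
  have hFi : Integrable fun t : ℝ => F (t * I) := by
    simpa using hF.integrable_line (k := 0) (by simp)
  have h1 : ∀ t : ℝ, H (t * I) * W2 (t * I) y / (Gamma (t * I) * Gamma (-(t * I))) =
      (Real.sqrt y : ℂ) * ∫ r : ℝ, F (t * I) *
        ((Real.exp (-x * Real.cosh r) : ℂ) * Complex.cosh (t * I * r)) := by
    intro t
    rw [div_eq_mul_inv, inv_Gamma_mul_Gamma_neg, integral_const_mul, ← KBessel_mul_I_eq t hx, W2,
      hFdef, spectralDensity]
    ring
  have hint : Integrable (Function.uncurry fun t r : ℝ => F (t * I) *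
      ((Real.exp (-x * Real.cosh r) : ℂ) * Complex.cosh (t * I * r))) (volume.prod volume) := by
    refine (hFi.norm.mul_prod (integrable_exp_neg_mul_cosh hx)).mono' ?_ (ae_of_all _ fun p => ?_)
    · refine Continuous.aestronglyMeasurable ?_
      exact (hFc.comp continuous_fst).mul (by fun_prop)
    · simp only [Function.uncurry]
      rw [norm_mul, norm_mul, norm_real, Real.norm_of_nonneg (Real.exp_pos _).le]
      gcongr
      exact mul_le_of_le_one_right (Real.exp_pos _).le (norm_cosh_mul_I_mul_le _ _)
  rw [Hflat]
  simp only [h1]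
  rw [integral_const_mul, integral_integral_swap hint, mul_assoc]
  congr 3 with r
  rw [← hF.integral_mul_cosh le_rfl heven, ← integral_const_mul]
  congr 1 with t
  ring

lemma norm_exp_neg_sub_sum_le {z : ℝ} (hz : 0 ≤ z) (n : ℕ) :
    ‖(Real.exp (-z) : ℂ) - ∑ m ∈ Finset.range n, (-(z : ℂ)) ^ m / m.factorial‖ ≤
      (n + 3) * z ^ n := by
  have hzn : 0 ≤ z ^ n := pow_nonneg hz n
  have hnorm : ‖(-(z : ℂ))‖ = z := by simp [abs_of_nonneg hz]
  rw [ofReal_exp, ofReal_neg]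
  rcases le_total z 1 with h | h
  · refine (Complex.norm_exp_sub_sum_le_norm_mul_exp _ n).trans ?_
    rw [hnorm, mul_comm]
    gcongr
    have := Real.exp_le_exp.2 h
    have := Real.exp_one_lt_d9
    have : (0 : ℝ) ≤ n := n.cast_nonneg
    linarith
  · refine (norm_sub_le _ _).trans ?_
    have h1 : ‖cexp (-(z : ℂ))‖ ≤ 1 := by
      rw [norm_exp]
      exact Real.exp_le_one_iff.2 (by simpa using hz)
    have h2 : ‖∑ m ∈ Finset.range n, (-(z : ℂ)) ^ m / m.factorial‖ ≤ n * z ^ n := by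
      refine (norm_sum_le_of_le (f := fun m : ℕ => (-(z : ℂ)) ^ m / m.factorial)
        (n := fun _ => z ^ n) _ fun m hm => ?_).trans (by simp)
      rw [norm_div, norm_pow, hnorm, Complex.norm_natCast]
      have hm' : m ≤ n := (Finset.mem_range.1 hm).le
      have : (1 : ℝ) ≤ m.factorial := by exact_mod_cast m.factorial_pos
      exact (div_le_self (by positivity) this).trans (pow_le_pow_right₀ h hm')
    have h3 : 1 ≤ z ^ n := one_le_pow₀ h
    linarith

/-- Exponential moments with hyperbolic cosine weights vanish when `F` vanishes at integers. -/
lemma StripDecay.integral_cosh_pow_mul_exp {B C : ℝ} {F : ℂ → ℂ} (hF : StripDecay B C F)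
    (hB : 0 ≤ B) (hz : ∀ k : ℤ, F k = 0) (n : ℕ) (k : ℤ) (hk : |(k : ℝ)| + n < B) :
    Integrable (fun r : ℝ =>
      (Real.cosh r : ℂ) ^ n * ((Real.exp (k * r) : ℂ) * axisFourier F r)) ∧
    ∫ r : ℝ, (Real.cosh r : ℂ) ^ n * ((Real.exp (k * r) : ℂ) * axisFourier F r) = 0 := by
  induction n generalizing k with
  | zero =>
    have hk' : |(k : ℝ)| < B := by simpa using hk
    refine ⟨by simpa using hF.integrable_exp_mul_axisFourier hB hk', ?_⟩
    have h := hF.integral_exp_mul_axisFourier hB hk'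
    have hz' : F (-((k : ℝ) : ℂ)) = 0 := by simpa using hz (-k)
    rw [hz', mul_zero] at h
    simpa using h
  | succ n ih =>
    push_cast at hk
    have hplus := ih (k + 1) (by
      push_cast
      linarith [abs_add_le (k : ℝ) 1, abs_one (α := ℝ)])
    have hminus := ih (k - 1) (by
      push_cast
      linarith [abs_sub (k : ℝ) 1, abs_one (α := ℝ)])
    have e : ∀ r : ℝ, (Real.cosh r : ℂ) ^ (n + 1) * ((Real.exp (k * r) : ℂ) * axisFourier F r) =
        2⁻¹ * ((Real.cosh r : ℂ) ^ n * ((Real.exp ((k + 1 : ℤ) * r) : ℂ) * axisFourier F r) +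
          (Real.cosh r : ℂ) ^ n * ((Real.exp ((k - 1 : ℤ) * r) : ℂ) * axisFourier F r)) := by
      intro r
      have h1 : Real.exp ((k + 1 : ℤ) * r) = Real.exp (k * r) * Real.exp r := by
        rw [← Real.exp_add]; push_cast; ring_nf
      have h2 : Real.exp ((k - 1 : ℤ) * r) = Real.exp (k * r) * Real.exp (-r) := by
        rw [← Real.exp_add]; push_cast; ring_nf
      rw [h1, h2, pow_succ, show (Real.cosh r : ℂ) = (Real.exp r + Real.exp (-r)) / 2 by
        rw [Real.cosh_eq]; push_cast; ring]
      push_cast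
      ring
    simp only [e]
    refine ⟨(hplus.1.add hminus.1).const_mul _, ?_⟩
    rw [integral_const_mul, integral_add hplus.1 hminus.1, hplus.2, hminus.2]
    simp

/-- The Laplace-type transform of an axis Fourier transform with vanishing moments vanishes to
high order at `0`. -/
lemma StripDecay.exists_norm_laplace_le {B C : ℝ} {F : ℂ → ℂ} (hF : StripDecay B C F)
    (hB : 0 ≤ B) (hz : ∀ k : ℤ, F k = 0) {n : ℕ} (hn : (n : ℝ) < B) :
    ∃ D, ∀ x : ℝ, 0 < x →
      ‖∫ r : ℝ, (Real.exp (-x * Real.cosh r) : ℂ) * axisFourier F r‖ ≤ D * x ^ n := by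
  have hmom : ∀ m : ℕ, m ≤ n → Integrable (fun r : ℝ => (Real.cosh r : ℂ) ^ m * axisFourier F r) ∧
      ∫ r : ℝ, (Real.cosh r : ℂ) ^ m * axisFourier F r = 0 := by
    intro m hm
    have hm' : (m : ℝ) ≤ n := by exact_mod_cast hm
    simpa using hF.integral_cosh_pow_mul_exp hB hz m 0 (by simp; linarith)
  refine ⟨(n + 3) * ∫ r : ℝ, ‖(Real.cosh r : ℂ) ^ n * axisFourier F r‖, fun x hx => ?_⟩
  have hg : Integrable (axisFourier F) := by simpa using (hmom 0 n.zero_le).1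
  have hexp : Integrable fun r : ℝ =>
      (Real.exp (-x * Real.cosh r) : ℂ) * axisFourier F r := by
    refine hg.norm.mono' ((Continuous.aestronglyMeasurable (by fun_prop)).mul
      hg.aestronglyMeasurable) (ae_of_all _ fun r => ?_)
    rw [norm_mul, norm_real, Real.norm_of_nonneg (Real.exp_pos _).le]
    refine mul_le_of_le_one_left (norm_nonneg _) (Real.exp_le_one_iff.2 ?_)
    nlinarith [Real.cosh_pos r]
  have hterm : ∀ m ∈ Finset.range n, Integrable fun r : ℝ =>
      ((-x : ℂ) ^ m / m.factorial) * ((Real.cosh r : ℂ) ^ m * axisFourier F r) := fun m hm =>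
    (hmom m (Finset.mem_range.1 hm).le).1.const_mul _
  have hsum : ∫ r : ℝ, ∑ m ∈ Finset.range n,
      ((-x : ℂ) ^ m / m.factorial) * ((Real.cosh r : ℂ) ^ m * axisFourier F r) = 0 := by
    rw [integral_finsetSum _ hterm]
    refine Finset.sum_eq_zero fun m hm => ?_
    rw [integral_const_mul, (hmom m (Finset.mem_range.1 hm).le).2, mul_zero]
  rw [← sub_zero (∫ r : ℝ, (Real.exp (-x * Real.cosh r) : ℂ) * axisFourier F r), ← hsum,
    ← integral_sub hexp (integrable_finsetSum _ hterm), mul_right_comm, ← integral_const_mul]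
  refine norm_integral_le_of_norm_le ((hmom n le_rfl).1.norm.const_mul _) (ae_of_all _ fun r => ?_)
  have hpos : 0 ≤ x * Real.cosh r := mul_nonneg hx.le (Real.cosh_pos r).le
  have e : (Real.exp (-x * Real.cosh r) : ℂ) * axisFourier F r - ∑ m ∈ Finset.range n,
      ((-x : ℂ) ^ m / m.factorial) * ((Real.cosh r : ℂ) ^ m * axisFourier F r) =
      ((Real.exp (-(x * Real.cosh r)) : ℂ) - ∑ m ∈ Finset.range n,
        (-((x * Real.cosh r : ℝ) : ℂ)) ^ m / m.factorial) * axisFourier F r := by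
    rw [sub_mul, Finset.sum_mul, neg_mul]
    congr 1
    refine Finset.sum_congr rfl fun m _ => ?_
    rw [ofReal_mul, ← neg_mul, mul_pow]
    ring
  rw [e, norm_mul]
  refine (mul_le_mul_of_nonneg_right (norm_exp_neg_sub_sum_le hpos n) (norm_nonneg _)).trans
    (le_of_eq ?_)
  rw [norm_mul, norm_pow, norm_real, Real.norm_of_nonneg (Real.cosh_pos r).le, mul_pow]
  ring

lemma exists_norm_Hflat_le {η : ℝ} (hη : 40 < η) {H : ℂ → ℂ} (hH : MemCeta η H) {n : ℕ}
    (hn : n < 80) : ∃ D, ∀ y : ℝ, 0 < y → ‖Hflat H y‖ ≤ D * y ^ ((n : ℝ) + 1 / 2) := by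
  obtain ⟨C, hF⟩ := exists_stripDecay_spectralDensity hH (show 80 < 2 * η by linarith)
  obtain ⟨D, hD⟩ := hF.exists_norm_laplace_le (by norm_num) (spectralDensity_intCast H)
    (show (n : ℝ) < 80 by exact_mod_cast hn)
  refine ⟨1 / (4 * Real.pi) * (D * (2 * Real.pi) ^ n), fun y hy => ?_⟩
  rw [Hflat_eq hη hH hy, norm_mul, norm_mul, norm_real, Real.norm_of_nonneg (Real.sqrt_nonneg y),
    Real.rpow_add hy, Real.rpow_natCast, ← Real.sqrt_eq_rpow]
  have e : ‖(1 / (4 * (Real.pi : ℂ)))‖ = 1 / (4 * Real.pi) := by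
    simp [abs_of_pos Real.pi_pos]
  rw [e]
  calc _ ≤ 1 / (4 * Real.pi) * Real.sqrt y * (D * (2 * Real.pi * y) ^ n) := by
        gcongr
        exact hD _ (by positivity)
    _ = _ := by rw [mul_pow]; ring

lemma continuousOn_Hflat {η : ℝ} (hη : 40 < η) {H : ℂ → ℂ} (hH : MemCeta η H) :
    ContinuousOn (Hflat H) (Ioi 0) := by
  obtain ⟨C, hF⟩ := exists_stripDecay_spectralDensity hH (show 1 < 2 * η by linarith)
  have hg : Integrable (axisFourier (spectralDensity H)) := by
    simpa using hF.integrable_exp_mul_axisFourier zero_le_one (k := 0) (by simp)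
  refine ContinuousOn.congr ?_ fun y hy => Hflat_eq hη hH hy
  refine ContinuousOn.mul (by fun_prop) ?_
  refine continuousOn_of_dominated (bound := fun r => ‖axisFourier (spectralDensity H) r‖)
    (fun y _ => (Continuous.aestronglyMeasurable (by fun_prop)).mul hg.aestronglyMeasurable)
    (fun y hy => ae_of_all _ fun r => ?_) hg.norm (ae_of_all _ fun r => by fun_prop)
  rw [norm_mul, norm_real, Real.norm_of_nonneg (Real.exp_pos _).le]
  refine mul_le_of_le_one_left (norm_nonneg _) (Real.exp_le_one_iff.2 ?_)
  have hy' : (0 : ℝ) < y := hy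
  have : 0 ≤ 2 * Real.pi * y * Real.cosh r := by have := Real.cosh_pos r; positivity
  linarith

/-! ### The Mellin transform of `Hflat` -/

lemma mellinT_eq_mellin (h : ℝ → ℂ) : mellinT h = mellin h := by
  ext w
  simp only [mellinT, mellin, smul_eq_mul, mul_comm]

section

variable {η : ℝ} {H : ℂ → ℂ}

lemma isBigO_Hflat_atTop (hη : 40 < η) (hH : MemCeta η H) :
    Hflat H =O[Filter.atTop] fun y : ℝ => y ^ (-(-1 / 2) : ℝ) := by
  obtain ⟨D, hD⟩ := exists_norm_Hflat_le hη hH (n := 0) (by norm_num)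
  refine Asymptotics.IsBigO.of_bound D ?_
  filter_upwards [Filter.eventually_gt_atTop 0] with y hy
  rw [Real.norm_of_nonneg (Real.rpow_nonneg hy.le _)]
  convert hD y hy using 3
  norm_num

lemma isBigO_Hflat_zero (hη : 40 < η) (hH : MemCeta η H) :
    Hflat H =O[nhdsWithin 0 (Ioi 0)] fun y : ℝ => y ^ (-(-33 / 2) : ℝ) := by
  obtain ⟨D, hD⟩ := exists_norm_Hflat_le hη hH (n := 16) (by norm_num)
  refine Asymptotics.IsBigO.of_bound D ?_
  filter_upwards [self_mem_nhdsWithin] with y hy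
  rw [Real.norm_of_nonneg (Real.rpow_nonneg (le_of_lt hy) _)]
  convert hD y hy using 3
  norm_num

lemma locallyIntegrableOn_Hflat (hη : 40 < η) (hH : MemCeta η H) :
    LocallyIntegrableOn (Hflat H) (Ioi 0) :=
  (continuousOn_Hflat hη hH).locallyIntegrableOn measurableSet_Ioi

lemma differentiableAt_mellinT_Hflat (hη : 40 < η) (hH : MemCeta η H) {w : ℂ}
    (h1 : -33 / 2 < w.re) (h2 : w.re < -1 / 2) :
    DifferentiableAt ℂ (mellinT (Hflat H)) w := by
  rw [mellinT_eq_mellin]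
  exact mellin_differentiableAt_of_isBigO_rpow (locallyIntegrableOn_Hflat hη hH)
    (isBigO_Hflat_atTop hη hH) h2 (isBigO_Hflat_zero hη hH) h1

lemma exists_norm_mellinT_Hflat_le (hη : 40 < η) (hH : MemCeta η H) :
    ∃ M, ∀ w : ℂ, -16 ≤ w.re → w.re ≤ -1 → ‖mellinT (Hflat H) w‖ ≤ M := by
  have hconv : ∀ σ : ℝ, -33 / 2 < σ → σ < -1 / 2 →
      IntegrableOn (fun y : ℝ => ‖Hflat H y‖ * y ^ (σ - 1)) (Ioi 0) := by
    intro σ h1 h2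
    have h := mellinConvergent_of_isBigO_rpow (s := (σ : ℂ)) (locallyIntegrableOn_Hflat hη hH)
      (isBigO_Hflat_atTop hη hH) (by simpa using h2) (isBigO_Hflat_zero hη hH) (by simpa using h1)
    refine IntegrableOn.congr_fun h.norm (fun y hy => ?_) measurableSet_Ioi
    simp only [norm_smul]
    rw [norm_cpow_eq_rpow_re_of_pos hy, mul_comm]
    simp
  have hi := (hconv (-16) (by norm_num) (by norm_num)).add (hconv (-1) (by norm_num) (by norm_num))
  refine ⟨_, fun w h1 h2 => norm_integral_le_of_norm_le hi ?_⟩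
  filter_upwards [ae_restrict_mem measurableSet_Ioi] with y hy
  have hy' : (0 : ℝ) < y := hy
  rw [norm_mul, norm_cpow_eq_rpow_re_of_pos hy', sub_re, one_re, Pi.add_apply, ← mul_add]
  refine mul_le_mul_of_nonneg_left ?_ (norm_nonneg _)
  rcases le_total y 1 with h | h
  · have := Real.rpow_le_rpow_of_exponent_ge hy' h (show -16 - 1 ≤ w.re - 1 by linarith)
    have := Real.rpow_nonneg hy'.le (-1 - 1)
    linarith
  · have := Real.rpow_le_rpow_of_exponent_le h (show w.re - 1 ≤ -1 - 1 by linarith)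
    have := Real.rpow_nonneg hy'.le (-16 - 1)
    linarith

end
/-- Cauchy's estimate for the Fréchet derivative of a holomorphic function bounded on a ball. -/
lemma norm_fderiv_le_of_forall_mem_ball_norm_le {E : Type*} [NormedAddCommGroup E]
    [NormedSpace ℂ E] {f : E → ℂ} {x : E} {R C : ℝ} (hR : 0 < R)
    (hf : DifferentiableOn ℂ f (Metric.ball x R)) (hC : ∀ y ∈ Metric.ball x R, ‖f y‖ ≤ C) :
    ‖fderiv ℂ f x‖ ≤ 2 * C / R := by
  have hC0 : 0 ≤ C := (norm_nonneg _).trans (hC x (Metric.mem_ball_self hR))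
  refine ContinuousLinearMap.opNorm_le_bound _ (by positivity) fun v => ?_
  rcases eq_or_ne v 0 with rfl | hv
  · simp
  have hv' : 0 < ‖v‖ := norm_pos_iff.2 hv
  have hmem : ∀ ζ ∈ Metric.closedBall (0 : ℂ) (R / (2 * ‖v‖)), x + ζ • v ∈ Metric.ball x R := by
    intro ζ hζ
    rw [mem_closedBall_zero_iff, le_div_iff₀ (by positivity)] at hζ
    rw [mem_ball_iff_norm, add_sub_cancel_left, norm_smul]
    linarith
  have hd : DifferentiableOn ℂ (fun ζ : ℂ => f (x + ζ • v))
      (Metric.closedBall 0 (R / (2 * ‖v‖))) :=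
    hf.comp (by fun_prop) hmem
  have hcl : closure (Metric.ball (0 : ℂ) (R / (2 * ‖v‖))) ⊆
      Metric.closedBall 0 (R / (2 * ‖v‖)) := Metric.closure_ball_subset_closedBall
  have hderiv : HasDerivAt (fun ζ : ℂ => f (x + ζ • v)) (fderiv ℂ f x v) 0 := by
    have h1 : HasFDerivAt f (fderiv ℂ f x) (x + (0 : ℂ) • v) := by
      rw [zero_smul, add_zero]
      exact (hf.differentiableAt (Metric.ball_mem_nhds x hR)).hasFDerivAt
    have h2 : HasDerivAt (fun ζ : ℂ => x + ζ • v) v 0 := by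
      simpa using ((hasDerivAt_id (0 : ℂ)).smul_const v).const_add x
    exact h1.comp_hasDerivAt 0 h2
  have := Complex.norm_deriv_le_of_forall_mem_sphere_norm_le (c := 0) (R := R / (2 * ‖v‖))
    (by positivity) (hd.mono hcl).diffContOnCl
    fun z hz => hC _ (hmem z (Metric.sphere_subset_closedBall hz))
  rw [hderiv.deriv] at this
  refine this.trans (le_of_eq ?_)
  field_simp

lemma aestronglyMeasurable_fderiv_apply {Z E : Type*} [MeasurableSpace Z] {μ : Measure Z}
    [NormedAddCommGroup E] [NormedSpace ℂ E] {F : E → Z → ℂ} {U : Set E} {x : E}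
    (hU : U ∈ nhds x) (hmeas : ∀ y ∈ U, AEStronglyMeasurable (F y) μ)
    (hdiff : ∀ z, DifferentiableAt ℂ (F · z) x) (v : E) :
    AEStronglyMeasurable (fun z => fderiv ℂ (F · z) x v) μ := by
  have hlim : Filter.Tendsto (fun n : ℕ => x + ((n : ℂ) + 1)⁻¹ • v) Filter.atTop (nhds x) := by
    have h : Filter.Tendsto (fun n : ℕ => ((n : ℂ) + 1)⁻¹) Filter.atTop (nhds 0) := by
      simpa [one_div] using tendsto_one_div_add_atTop_nhds_zero_nat (𝕜 := ℂ)
    simpa using (h.smul_const v).const_add x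
  obtain ⟨N, hN⟩ := Filter.eventually_atTop.1 (hlim.eventually hU)
  refine aestronglyMeasurable_of_tendsto_ae (u := Filter.atTop)
    (f := fun (n : ℕ) z =>
      (((n + N : ℕ) : ℂ) + 1) • (F (x + (((n + N : ℕ) : ℂ) + 1)⁻¹ • v) z - F x z))
    (fun n => ?_) (ae_of_all _ fun z => ?_)
  · exact ((hmeas _ (hN (n + N) (by omega))).sub (hmeas _ (mem_of_mem_nhds hU))).const_smul
      (((n + N : ℕ) : ℂ) + 1)
  · have hc : Filter.Tendsto (fun n : ℕ => ‖((n + N : ℕ) : ℂ) + 1‖) Filter.atTop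
        Filter.atTop := by
      have : (fun n : ℕ => ‖((n + N : ℕ) : ℂ) + 1‖) = fun n : ℕ => ((n + N : ℕ) : ℝ) + 1 := by
        funext n
        rw [← Nat.cast_succ, Complex.norm_natCast, Nat.cast_succ]
      rw [this]
      exact Filter.tendsto_atTop_add_const_right _ _
        (tendsto_natCast_atTop_atTop.comp (Filter.tendsto_add_atTop_nat N))
    refine (hdiff z).hasFDerivAt.lim v hc |>.congr fun n => ?_
    rfl

/-- A dominated integral of functions holomorphic in a parameter is holomorphic. -/
lemma differentiableOn_integral_of_locally_dominated {Z : Type*} [MeasurableSpace Z]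
    {μ : Measure Z} {F : ℂ × ℂ → Z → ℂ} {U : Set (ℂ × ℂ)} (hU : IsOpen U)
    (hmeas : ∀ x ∈ U, AEStronglyMeasurable (F x) μ)
    (hdiff : ∀ z, DifferentiableOn ℂ (F · z) U)
    (hbound : ∀ x ∈ U, ∃ V ∈ nhds x, ∃ b : Z → ℝ, Integrable b μ ∧
      ∀ y ∈ V, ∀ z, ‖F y z‖ ≤ b z) :
    DifferentiableOn ℂ (fun x => ∫ z, F x z ∂μ) U := by
  intro x hx
  obtain ⟨V, hV, b, hb, hFb⟩ := hbound x hx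
  obtain ⟨R, hR, hball⟩ := Metric.mem_nhds_iff.1 (Filter.inter_mem hV (hU.mem_nhds hx))
  have hsub : ∀ y ∈ Metric.ball x (R / 2), Metric.ball y (R / 2) ⊆ V ∩ U := by
    intro y hy
    refine (Metric.ball_subset_ball' ?_).trans hball
    rw [Metric.mem_ball] at hy
    linarith
  have hdiffAt : ∀ z, ∀ y ∈ U, DifferentiableAt ℂ (F · z) y := fun z y hy =>
    (hdiff z).differentiableAt (hU.mem_nhds hy)
  have hmemU : ∀ y ∈ Metric.ball x (R / 2), y ∈ U := fun y hy =>
    (hsub y hy (Metric.mem_ball_self (by positivity))).2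
  refine (hasFDerivAt_integral_of_dominated_of_fderiv_le
    (F' := fun y z => fderiv ℂ (F · z) y) (s := Metric.ball x (R / 2))
    (bound := fun z => 2 * b z / (R / 2))
    (Metric.ball_mem_nhds x (by positivity))
    ?_ ?_ ?_ ?_ ?_ ?_).differentiableAt.differentiableWithinAt
  · filter_upwards [hU.mem_nhds hx] with y hy using hmeas y hy
  · exact hb.mono' (hmeas x hx) (ae_of_all _ (hFb x (mem_of_mem_nhds hV)))
  · have h := fun v => aestronglyMeasurable_fderiv_apply (μ := μ) (hU.mem_nhds hx) hmeas
      (fun z => hdiffAt z x hx) v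
    have heq : (fun z => fderiv ℂ (F · z) x) = fun z =>
        fderiv ℂ (F · z) x (1, 0) • ContinuousLinearMap.fst ℂ ℂ ℂ +
          fderiv ℂ (F · z) x (0, 1) • ContinuousLinearMap.snd ℂ ℂ ℂ := by
      funext z
      ext <;> simp
    rw [heq]
    exact ((h (1, 0)).smul_const _).add ((h (0, 1)).smul_const _)
  · refine ae_of_all _ fun z y hy => ?_
    exact norm_fderiv_le_of_forall_mem_ball_norm_le (by positivity)
      ((hdiff z).mono fun w hw => (hsub y hy hw).2) fun w hw => hFb w (hsub y hy hw).1 z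
  · exact (hb.const_mul 2).div_const _
  · exact ae_of_all _ fun z y hy => (hdiffAt z y (hmemU y hy)).hasFDerivAt

lemma exists_norm_GammaR_le {θ : ℝ} (hθ : θ < Real.pi / 4) {a : ℝ} (ha : 0 < a) (b : ℝ) :
    ∃ C > 0, ∀ s : ℂ, a ≤ s.re → s.re ≤ b → ‖GammaR s‖ ≤ C * Real.exp (-θ * |s.im|) := by
  obtain ⟨C, hC, h⟩ := exists_norm_Gamma_le (θ := 2 * θ) (by linarith) (half_pos ha) (b / 2)
  refine ⟨C, hC, fun s h1 h2 => ?_⟩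
  have hg := h (s / 2) (by rw [div_ofNat_re]; linarith) (by rw [div_ofNat_re]; linarith)
  have hpi : ‖(Real.pi : ℂ) ^ (-s / 2)‖ ≤ 1 := by
    rw [norm_cpow_eq_rpow_re_of_pos Real.pi_pos]
    refine Real.rpow_le_one_of_one_le_of_nonpos (by linarith [Real.pi_gt_three]) ?_
    rw [div_ofNat_re, neg_re]
    linarith
  rw [GammaR, norm_mul]
  refine (mul_le_mul hpi hg (norm_nonneg _) zero_le_one).trans (le_of_eq ?_)
  rw [div_ofNat_im, abs_div, abs_of_pos (two_pos : (0 : ℝ) < 2)]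
  ring_nf

lemma exists_inv_norm_GammaR_le {θ : ℝ} (hθ : Real.pi / 4 < θ) {a : ℝ} (ha : 0 < a) (b : ℝ) :
    ∃ C > 0, ∀ s : ℂ, a ≤ s.re → s.re ≤ b → ‖GammaR s‖⁻¹ ≤ C * Real.exp (θ * |s.im|) := by
  obtain ⟨C, hC, h⟩ := exists_inv_norm_Gamma_le (θ := 2 * θ) (by linarith) (half_pos ha) (b / 2)
  refine ⟨Real.pi ^ (b / 2) * C, by positivity, fun s h1 h2 => ?_⟩
  have hg := h (s / 2) (by rw [div_ofNat_re]; linarith) (by rw [div_ofNat_re]; linarith)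
  have hpi : ‖(Real.pi : ℂ) ^ (-s / 2)‖⁻¹ ≤ Real.pi ^ (b / 2) := by
    rw [norm_cpow_eq_rpow_re_of_pos Real.pi_pos, ← Real.rpow_neg Real.pi_pos.le]
    refine Real.rpow_le_rpow_of_exponent_le (by linarith [Real.pi_gt_three]) ?_
    rw [div_ofNat_re, neg_re]
    linarith
  rw [GammaR, norm_mul, mul_inv]
  refine (mul_le_mul hpi hg (by positivity) (by positivity)).trans (le_of_eq ?_)
  rw [div_ofNat_im, abs_div, abs_of_pos (two_pos : (0 : ℝ) < 2)]
  ring_nf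

lemma differentiableAt_Gamma_of_re_pos {s : ℂ} (hs : 0 < s.re) :
    DifferentiableAt ℂ Complex.Gamma s := by
  refine differentiableAt_Gamma s fun m h => ?_
  rw [h, neg_re, natCast_re] at hs
  linarith [(Nat.cast_nonneg m : (0 : ℝ) ≤ m)]

lemma differentiableAt_GammaR_of_re_pos {s : ℂ} (hs : 0 < s.re) : DifferentiableAt ℂ GammaR s := by
  have hpi : (Real.pi : ℂ) ≠ 0 := ofReal_ne_zero.2 Real.pi_ne_zero
  have h2 : 0 < (s / 2).re := by rw [div_ofNat_re]; linarith
  have h1 : DifferentiableAt ℂ (fun s : ℂ => (Real.pi : ℂ) ^ (-s / 2)) s :=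
    (by fun_prop : DifferentiableAt ℂ (fun s : ℂ => -s / 2) s).const_cpow (Or.inl hpi)
  exact h1.mul ((differentiableAt_Gamma_of_re_pos h2).comp s (by fun_prop))

lemma GammaR_ne_zero_of_re_pos {s : ℂ} (hs : 0 < s.re) : GammaR s ≠ 0 := by
  have hpi : (Real.pi : ℂ) ≠ 0 := ofReal_ne_zero.2 Real.pi_ne_zero
  refine mul_ne_zero (by simp [cpow_eq_zero_iff, hpi]) (Complex.Gamma_ne_zero_of_re_pos ?_)
  rw [div_ofNat_re]
  linarith

/-- The Gamma kernel is holomorphic where all its Gamma factors have arguments of positive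
real part. -/
lemma DifferentiableAt.gkerPhi {E : Type*} [NormedAddCommGroup E] [NormedSpace ℂ E]
    {α : Fin 3 → ℂ} (hre : ∀ i, (α i).re = 0) (δ φ : ℝ) {s1 u s0 s : E → ℂ} {x : E}
    (h1 : DifferentiableAt ℂ s1 x) (hu : DifferentiableAt ℂ u x) (h0 : DifferentiableAt ℂ s0 x)
    (hs : DifferentiableAt ℂ s x) (p1 : 0 < (s1 x).re) (pu : 0 < (u x).re)
    (p0 : (u x).re < (s0 x).re)
    (pa : 0 < (u x).re + 1 - 2 * (s x).re + (s1 x).re - (s0 x).re)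
    (pb : 0 < 2 * (s x).re - (s0 x).re - (u x).re)
    (pc : 0 < (1 + (s1 x).re) / 2 - (s0 x).re) :
    DifferentiableAt ℂ (fun x => GkerPhi α δ φ (s1 x) (u x) (s0 x) (s x)) x := by
  have hpi : (2 * Real.pi : ℂ) ≠ 0 := by
    simp
  have hG : ∀ {f : E → ℂ}, DifferentiableAt ℂ f x → 0 < (f x).re →
      DifferentiableAt ℂ (fun x => Complex.Gamma (f x)) x := fun hf h =>
    (differentiableAt_Gamma_of_re_pos h).fun_comp' x hf
  have hGR : ∀ {f : E → ℂ}, DifferentiableAt ℂ f x → 0 < (f x).re →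
      DifferentiableAt ℂ (fun x => GammaR (f x)) x := fun hf h =>
    (differentiableAt_GammaR_of_re_pos h).fun_comp' x hf
  have hα0 : ∀ i, 0 < (s0 x - u x + α i).re := fun i => by
    simp only [add_re, sub_re, hre]; linarith
  have hα1 : ∀ i, 0 < (s1 x - α i).re := fun i => by
    simp only [sub_re, hre]; linarith
  have h01 : 0 < (s0 x - u x + s1 x).re := by simp only [add_re, sub_re]; linarith
  have hden : 0 < ((1 + s1 x) / 2 - s0 x).re := by
    simpa only [sub_re, div_ofNat_re, add_re, one_re] using pc
  have hΓa : 0 < ((u x + 1 - 2 * s x + s1 x - s0 x) / 2).re := by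
    simp [div_ofNat_re]; linarith
  have hΓb : 0 < ((2 * s x - s0 x - u x) / 2).re := by
    simp [div_ofNat_re]; linarith
  unfold GkerPhi Gfun
  simp only [Fin.prod_univ_three]
  have e0 := fun i => hGR ((h0.sub hu).add_const (α i)) (hα0 i)
  have e1 := fun i => hGR (h1.sub_const (α i)) (hα1 i)
  have e01 := hGR (f := fun x => s0 x - u x + s1 x) (by fun_prop) h01
  have ea := hG (f := fun x => (u x + 1 - 2 * s x + s1 x - s0 x) / 2) (by fun_prop) hΓa
  have eb := hG (f := fun x => (2 * s x - s0 x - u x) / 2) (by fun_prop) hΓb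
  have ec := hG (f := fun x => (1 + s1 x) / 2 - s0 x) (by fun_prop) hden
  have ep : DifferentiableAt ℂ (fun x => (2 * Real.pi : ℂ) ^ (-u x)) x :=
    hu.neg.const_cpow (Or.inl hpi)
  have ee : DifferentiableAt ℂ (fun x => Complex.exp (I * δ * φ * u x)) x := by fun_prop
  have eG := (((e0 0).fun_mul (e1 0)).fun_mul ((e0 1).fun_mul (e1 1))).fun_mul
    ((e0 2).fun_mul (e1 2))
  simp only [div_eq_mul_inv] at ea eb ec ⊢
  exact (((((((eG.fun_mul (e01.fun_inv (GammaR_ne_zero_of_re_pos h01))).fun_mul ep).fun_mul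
    ee).fun_mul (hG hu pu)).fun_mul ea).fun_mul eb).fun_mul
    (ec.fun_inv (by simpa only [div_eq_mul_inv] using Complex.Gamma_ne_zero_of_re_pos hden)))

lemma norm_mul_le_mul_exp {a b : ℂ} {C D x y : ℝ} (ha : ‖a‖ ≤ C * Real.exp x)
    (hb : ‖b‖ ≤ D * Real.exp y) : ‖a * b‖ ≤ C * D * Real.exp (x + y) := by
  rw [norm_mul, Real.exp_add]
  refine (mul_le_mul ha hb (norm_nonneg _) ((norm_nonneg _).trans ha)).trans (le_of_eq ?_)
  ring

lemma norm_div_le_mul_exp {a b : ℂ} {C D x y : ℝ} (ha : ‖a‖ ≤ C * Real.exp x)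
    (hb : ‖b‖⁻¹ ≤ D * Real.exp y) : ‖a / b‖ ≤ C * D * Real.exp (x + y) := by
  rw [div_eq_mul_inv]
  exact norm_mul_le_mul_exp ha (by rwa [norm_inv])

lemma mul_exp_le_mul_exp {C x y : ℝ} (hC : 0 < C) (h : x ≤ y) :
    C * Real.exp x ≤ C * Real.exp y :=
  mul_le_mul_of_nonneg_left (Real.exp_le_exp.2 h) hC.le

lemma abs_sub_le_abs_of_abs_add_le {x y D : ℝ} (h : |x + y| ≤ D) : |x| - D ≤ |y| := by
  grind

lemma abs_le_abs_add_of_abs_sub_le {x y D : ℝ} (h : |y - x| ≤ D) : |y| ≤ |x| + D := by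
  grind

lemma exists_norm_Gfun_le {α : Fin 3 → ℂ} (hre : ∀ i, (α i).re = 0) {c : ℝ}
    (hc : c = Real.pi / 32) {ε : ℝ} (hε : 0 < ε) (B : ℝ) :
    ∃ C > 0, ∀ s0 : ℂ, 1 / 100 + ε ≤ s0.re → s0.re ≤ 8 → |s0.im| ≤ B → ∀ t v : ℝ,
      ‖Gfun α (s0 - (1 / 100 + v * I)) (15 + t * I)‖ ≤
        C * Real.exp (c * (-21 * |v| - 21 * |t| + 9 * |t - v|)) := by
  have hpi := Real.pi_pos
  have hcpos : 0 < c := by rw [hc]; positivity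
  obtain ⟨A, hA⟩ : ∃ A : ℝ, ∀ i, |(α i).im| ≤ A :=
    ⟨∑ i, |(α i).im|, fun i =>
      Finset.single_le_sum (f := fun i => |(α i).im|) (fun _ _ => abs_nonneg _)
        (Finset.mem_univ i)⟩
  obtain ⟨C0, hC0, h0⟩ := exists_norm_GammaR_le (θ := 7 * c) (by linarith) hε 8
  obtain ⟨C1, hC1, h1⟩ := exists_norm_GammaR_le (θ := 7 * c) (by linarith)
    (by norm_num : (0 : ℝ) < 15) 15
  obtain ⟨C2, hC2, h2⟩ := exists_inv_norm_GammaR_le (θ := 9 * c) (by linarith)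
    (by norm_num : (0 : ℝ) < 15) 23
  refine ⟨C0 * C1 * (C0 * C1) * (C0 * C1) * C2 * Real.exp (c * (42 * A + 30 * B)),
    by positivity, fun s0 p0 ps b0 t v => ?_⟩
  have hα0 (i : Fin 3) : ‖GammaR (s0 - (1 / 100 + v * I) + α i)‖ ≤
      C0 * Real.exp (-(7 * c) * (|v| - (B + A))) := by
    refine (h0 _ ?_ ?_).trans (mul_exp_le_mul_exp hC0 ?_)
    · simp [hre]; linarith
    · simp [hre]; linarith
    · have him : |v| - (B + A) ≤ |(s0 - (1 / 100 + v * I) + α i).im| := by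
        refine abs_sub_le_abs_of_abs_add_le ?_
        have : v + (s0 - (1 / 100 + v * I) + α i).im = s0.im + (α i).im := by simp; ring
        rw [this]
        exact (abs_add_le _ _).trans (add_le_add b0 (hA i))
      nlinarith
  have hα1 (i : Fin 3) : ‖GammaR (15 + t * I - α i)‖ ≤
      C1 * Real.exp (-(7 * c) * (|t| - A)) := by
    refine (h1 _ ?_ ?_).trans (mul_exp_le_mul_exp hC1 ?_)
    · simp [hre]
    · simp [hre]
    · have him : |t| - A ≤ |(15 + t * I - α i).im| := by
        rw [← abs_neg (_ : ℂ).im]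
        refine abs_sub_le_abs_of_abs_add_le ?_
        have : t + -(15 + t * I - α i).im = (α i).im := by simp
        rw [this]
        exact hA i
      nlinarith
  have h01 : ‖GammaR (s0 - (1 / 100 + v * I) + (15 + t * I))‖⁻¹ ≤
      C2 * Real.exp (9 * c * (|t - v| + B)) := by
    refine (h2 _ ?_ ?_).trans (mul_exp_le_mul_exp hC2 ?_)
    · simp; linarith
    · simp; linarith
    · have him : |(s0 - (1 / 100 + v * I) + (15 + t * I)).im| ≤ |t - v| + B := by
        refine abs_le_abs_add_of_abs_sub_le ?_
        have : (s0 - (1 / 100 + v * I) + (15 + t * I)).im - (t - v) = s0.im := by simp; ring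
        rwa [this]
      nlinarith
  have key := norm_div_le_mul_exp (norm_mul_le_mul_exp (norm_mul_le_mul_exp
    (norm_mul_le_mul_exp (hα0 0) (hα1 0)) (norm_mul_le_mul_exp (hα0 1) (hα1 1)))
    (norm_mul_le_mul_exp (hα0 2) (hα1 2))) h01
  rw [Gfun, Fin.prod_univ_three]
  refine key.trans (le_of_eq ?_)
  rw [mul_assoc _ (Real.exp (c * (42 * A + 30 * B))), ← Real.exp_add]
  ring_nf

/-- The Gamma kernel decays exponentially along the lines of integration, locally uniformly in
`(s₀, s)`. -/
lemma exists_norm_GkerPhi_le {α : Fin 3 → ℂ} (hre : ∀ i, (α i).re = 0) {δ φ : ℝ} (hδ : |δ| ≤ 1)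
    (hφ : |φ| ≤ Real.pi / 2) {ε : ℝ} (hε : 0 < ε) (B : ℝ) :
    ∃ C > 0, ∀ s0 s : ℂ, 1 / 100 + ε ≤ s0.re → s.re ≤ 4 → ε ≤ 2 * s.re - s0.re - 1 / 100 →
      |s0.im| ≤ B → |s.im| ≤ B → ∀ t v : ℝ,
      ‖GkerPhi α δ φ (15 + t * I) (1 / 100 + v * I) s0 s‖ ≤
        C * Real.exp (-(5 * Real.pi / 16) * (|t| + |v|)) := by
  have hpi := Real.pi_pos
  obtain ⟨c, hc⟩ : ∃ c : ℝ, c = Real.pi / 32 := ⟨_, rfl⟩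
  have hcpos : 0 < c := by rw [hc]; positivity
  obtain ⟨C0, hC0, h0⟩ := exists_norm_Gfun_le hre hc hε B
  obtain ⟨C3, hC3, h3⟩ := exists_norm_Gamma_le (θ := 14 * c) (by linarith)
    (by norm_num : (0 : ℝ) < 1 / 100) (1 / 100)
  obtain ⟨C4, hC4, h4⟩ := exists_norm_Gamma_le (θ := 14 * c) (by linarith) (half_pos hε) 8
  obtain ⟨C5, hC5, h5⟩ := exists_inv_norm_Gamma_le (θ := 18 * c) (by linarith) hε 8
  refine ⟨C0 * 1 * 1 * C3 * C4 * C4 * C5 * Real.exp (c * (60 * B)), by positivity,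
    fun s0 s p0 ps p b0 bs t v => ?_⟩
  have hpow : ‖(2 * (Real.pi : ℂ)) ^ (-(1 / 100 + v * I))‖ ≤ 1 * Real.exp 0 := by
    rw [show (2 * (Real.pi : ℂ)) = ((2 * Real.pi : ℝ) : ℂ) by push_cast; rfl,
      norm_cpow_eq_rpow_re_of_pos (by positivity), Real.exp_zero, mul_one]
    refine Real.rpow_le_one_of_one_le_of_nonpos (by linarith [Real.pi_gt_three]) ?_
    simp
  have hexp : ‖Complex.exp (I * δ * φ * (1 / 100 + v * I))‖ ≤ 1 * Real.exp (16 * c * |v|) := by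
    rw [one_mul, Complex.norm_exp, Real.exp_le_exp]
    have : (I * δ * φ * (1 / 100 + v * I)).re = -(δ * φ * v) := by
      simp
    rw [this]
    refine (neg_le_abs _).trans ?_
    rw [abs_mul, abs_mul]
    have : |δ| * |φ| ≤ 16 * c := by
      nlinarith [abs_nonneg δ, abs_nonneg φ]
    gcongr
  have hΓu : ‖Complex.Gamma (1 / 100 + v * I)‖ ≤ C3 * Real.exp (-(14 * c) * |v|) := by
    refine (h3 _ ?_ ?_).trans (le_of_eq ?_) <;> simp
  have h2s : |2 * s.im| ≤ 2 * B := by rw [abs_mul, abs_two]; linarith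
  have hΓa : ‖Complex.Gamma ((1 / 100 + v * I + 1 - 2 * s + (15 + t * I) - s0) / 2)‖ ≤
      C4 * Real.exp (-(7 * c) * (|v + t| - (2 * B + B))) := by
    refine (h4 _ ?_ ?_).trans (mul_exp_le_mul_exp hC4 ?_)
    · simp [div_ofNat_re]; linarith
    · simp [div_ofNat_re]; linarith
    · have him : |v + t| - (2 * B + B) ≤
          2 * |((1 / 100 + v * I + 1 - 2 * s + (15 + t * I) - s0) / 2).im| := by
        rw [div_ofNat_im, abs_div, abs_two, mul_div_cancel₀ _ two_ne_zero,
          ← abs_neg (_ : ℂ).im]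
        refine abs_sub_le_abs_of_abs_add_le ?_
        have : v + t + -(1 / 100 + v * I + 1 - 2 * s + (15 + t * I) - s0).im =
            2 * s.im + s0.im := by simp; ring
        rw [this]
        exact (abs_add_le _ _).trans (add_le_add h2s b0)
      nlinarith
  have hΓb : ‖Complex.Gamma ((2 * s - s0 - (1 / 100 + v * I)) / 2)‖ ≤
      C4 * Real.exp (-(7 * c) * (|v| - (2 * B + B))) := by
    refine (h4 _ ?_ ?_).trans (mul_exp_le_mul_exp hC4 ?_)
    · simp [div_ofNat_re]; linarith
    · simp [div_ofNat_re]; linarith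
    · have him : |v| - (2 * B + B) ≤ 2 * |((2 * s - s0 - (1 / 100 + v * I)) / 2).im| := by
        rw [div_ofNat_im, abs_div, abs_two, mul_div_cancel₀ _ two_ne_zero]
        refine abs_sub_le_abs_of_abs_add_le ?_
        have : v + (2 * s - s0 - (1 / 100 + v * I)).im = 2 * s.im - s0.im := by simp
        rw [this]
        exact (abs_sub _ _).trans (add_le_add h2s b0)
      nlinarith
  have hΓc : ‖Complex.Gamma ((1 + (15 + t * I)) / 2 - s0)‖⁻¹ ≤
      C5 * Real.exp (18 * c * (|t / 2| + B)) := by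
    refine (h5 _ ?_ ?_).trans (mul_exp_le_mul_exp hC5 ?_)
    · simp [div_ofNat_re]; linarith
    · simp [div_ofNat_re]; linarith
    · have him : |((1 + (15 + t * I)) / 2 - s0).im| ≤ |t / 2| + B := by
        refine abs_le_abs_add_of_abs_sub_le ?_
        have : ((1 + (15 + t * I)) / 2 - s0).im - t / 2 = -s0.im := by
          simp [div_ofNat_im]
        rwa [this, abs_neg]
      nlinarith
  have key := norm_div_le_mul_exp (norm_mul_le_mul_exp (norm_mul_le_mul_exp (norm_mul_le_mul_exp
    (norm_mul_le_mul_exp (norm_mul_le_mul_exp (h0 s0 p0 (by linarith) b0 t v) hpow) hexp) hΓu)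
    hΓa) hΓb) hΓc
  rw [GkerPhi]
  refine key.trans ?_
  rw [mul_assoc _ (Real.exp (c * (60 * B))), ← Real.exp_add]
  refine mul_exp_le_mul_exp (by positivity) ?_
  have habs : 9 * |t - v| - 7 * |v + t| ≤ 2 * |t| + 16 * |v| := by
    have e1 : |t - v| ≤ |t| + |v| := abs_sub _ _
    have e2 : |t| - |v| ≤ |v + t| := by
      have := abs_sub_abs_le_abs_sub t (-v)
      rwa [abs_neg, sub_neg_eq_add, add_comm] at this
    linarith
  rw [show 5 * Real.pi / 16 = 10 * c by rw [hc]; ring, abs_div, abs_two]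
  have := mul_le_mul_of_nonneg_left habs hcpos.le
  linarith

/-- The domain of holomorphy of the archimedean transform. -/
def transformDomain : Set (ℂ × ℂ) :=
  {p : ℂ × ℂ | 1 / 100 < p.1.re ∧ p.2.re < 4 ∧ 0 < 2 * p.2.re - p.1.re - 1 / 100}

lemma isOpen_transformDomain : IsOpen transformDomain := by
  simp only [transformDomain, ofPred_and]
  refine (isOpen_lt ?_ ?_).inter ((isOpen_lt ?_ ?_).inter (isOpen_lt ?_ ?_)) <;> fun_prop

/-- The integrand of the archimedean transform. -/
noncomputable def transformIntegrand (α : Fin 3 → ℂ) (δ φ : ℝ) (H : ℂ → ℂ) (x : ℂ × ℂ)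
    (p : ℝ × ℝ) : ℂ :=
  mellinT (Hflat H) (x.2 - (15 + p.1 * I) - 1 / 2) *
    GkerPhi α δ φ (15 + p.1 * I) (1 / 100 + p.2 * I) x.1 x.2

section Transform

variable {η : ℝ} {H : ℂ → ℂ} {α : Fin 3 → ℂ} {δ φ : ℝ}

lemma continuous_transformIntegrand (hη : 40 < η) (hH : MemCeta η H)
    (hre : ∀ i, (α i).re = 0) {x : ℂ × ℂ} (hx : x ∈ transformDomain) :
    Continuous (transformIntegrand α δ φ H x) := by
  obtain ⟨h1, h2, h3⟩ := hx
  refine continuous_iff_continuousAt.2 fun p => ?_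
  have hM := differentiableAt_mellinT_Hflat hη hH (w := x.2 - (15 + p.1 * I) - 1 / 2)
    (by simp; linarith) (by simp; linarith)
  have hG : DifferentiableAt ℂ (fun q : ℂ × ℂ => GkerPhi α δ φ q.1 q.2 x.1 x.2)
      (15 + p.1 * I, 1 / 100 + p.2 * I) := by
    apply DifferentiableAt.gkerPhi hre δ φ differentiableAt_fst differentiableAt_snd
      (differentiableAt_const _) (differentiableAt_const _) <;> simp <;> linarith
  have cM : ContinuousAt (fun p : ℝ × ℝ => mellinT (Hflat H) (x.2 - (15 + p.1 * I) - 1 / 2)) p :=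
    ContinuousAt.comp' (f := fun p : ℝ × ℝ => x.2 - (15 + p.1 * I) - 1 / 2) hM.continuousAt
      (by fun_prop)
  have cG : ContinuousAt (fun p : ℝ × ℝ =>
      GkerPhi α δ φ (15 + p.1 * I) (1 / 100 + p.2 * I) x.1 x.2) p :=
    ContinuousAt.comp' (f := fun p : ℝ × ℝ => ((15 + p.1 * I, 1 / 100 + p.2 * I) : ℂ × ℂ))
      hG.continuousAt (by fun_prop)
  exact cM.mul cG

lemma differentiableOn_transformIntegrand (hη : 40 < η) (hH : MemCeta η H)
    (hre : ∀ i, (α i).re = 0) (p : ℝ × ℝ) :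
    DifferentiableOn ℂ (transformIntegrand α δ φ H · p) transformDomain := by
  rintro x ⟨h1, h2, h3⟩
  have hM := differentiableAt_mellinT_Hflat hη hH (w := x.2 - (15 + p.1 * I) - 1 / 2)
    (by simp; linarith) (by simp; linarith)
  have hG : DifferentiableAt ℂ
      (fun x : ℂ × ℂ => GkerPhi α δ φ (15 + p.1 * I) (1 / 100 + p.2 * I) x.1 x.2) x := by
    apply DifferentiableAt.gkerPhi hre δ φ (differentiableAt_const _) (differentiableAt_const _)
      differentiableAt_fst differentiableAt_snd <;> simp <;> linarith
  exact ((hM.fun_comp' x (by fun_prop)).fun_mul hG).differentiableWithinAt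

lemma exists_integrable_bound_transformIntegrand (hη : 40 < η) (hH : MemCeta η H)
    (hre : ∀ i, (α i).re = 0) (hδ : |δ| ≤ 1) (hφ : |φ| ≤ Real.pi / 2) {x : ℂ × ℂ}
    (hx : x ∈ transformDomain) :
    ∃ V ∈ nhds x, ∃ b : ℝ × ℝ → ℝ, Integrable b ∧
      ∀ y ∈ V, ∀ p, ‖transformIntegrand α δ φ H y p‖ ≤ b p := by
  obtain ⟨h1, h2, h3⟩ := hx
  obtain ⟨ε, hε, hε1, hε3⟩ : ∃ ε > 0, 1 / 100 + ε < x.1.re ∧ ε < 2 * x.2.re - x.1.re - 1 / 100 := by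
    obtain ⟨ε, hε, h⟩ := exists_between
      (lt_min (sub_pos.2 h1) h3 : 0 < min (x.1.re - 1 / 100) (2 * x.2.re - x.1.re - 1 / 100))
    exact ⟨ε, hε, by linarith [min_le_left (x.1.re - 1 / 100) (2 * x.2.re - x.1.re - 1 / 100)],
      h.trans_le (min_le_right _ _)⟩
  obtain ⟨B, hB⟩ := exists_gt (max |x.1.im| |x.2.im|)
  obtain ⟨C, hC, hG⟩ := exists_norm_GkerPhi_le hre hδ hφ hε B
  obtain ⟨M, hM⟩ := exists_norm_mellinT_Hflat_le hη hH
  have hV : IsOpen {y : ℂ × ℂ | 1 / 100 + ε < y.1.re ∧ y.2.re < 4 ∧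
      ε < 2 * y.2.re - y.1.re - 1 / 100 ∧ |y.1.im| < B ∧ |y.2.im| < B} := by
    simp only [ofPred_and]
    refine (isOpen_lt ?_ ?_).inter ((isOpen_lt ?_ ?_).inter ((isOpen_lt ?_ ?_).inter
      ((isOpen_lt ?_ ?_).inter (isOpen_lt ?_ ?_)))) <;> fun_prop
  refine ⟨_, hV.mem_nhds ⟨hε1, h2, hε3, (le_max_left _ _).trans_lt hB,
    (le_max_right _ _).trans_lt hB⟩, fun p => M * (C * (Real.exp (-(5 * Real.pi / 16) * |p.1|) *
      Real.exp (-(5 * Real.pi / 16) * |p.2|))), ?_, ?_⟩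
  · have he := integrable_exp_neg_mul_abs (c := 5 * Real.pi / 16) (by positivity)
    exact ((he.mul_prod he).const_mul C).const_mul M
  · rintro y ⟨y1, y2, y3, y4, y5⟩ p
    have hm := hM (y.2 - (15 + p.1 * I) - 1 / 2) (by simp; linarith) (by simp; linarith)
    have hg := hG y.1 y.2 y1.le y2.le y3.le y4.le y5.le p.1 p.2
    rw [mul_add, Real.exp_add] at hg
    rw [transformIntegrand, norm_mul]
    exact mul_le_mul hm hg (norm_nonneg _) ((norm_nonneg _).trans hm)

end Transform

/-- Holomorphy of the archimedean transform on
`Ω = {Re s₀ > 1/100, Re s < 4, 2 Re s − Re s₀ − 1/100 > 0}`, together with absolute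
convergence of the defining double integral. -/
theorem Ftrans_holomorphic (η : ℝ) (hη : 40 < η) (H : ℂ → ℂ) (hH : MemCeta η H)
    (α : Fin 3 → ℂ) (hre : ∀ i, (α i).re = 0) (hsum : α 0 + α 1 + α 2 = 0)
    (δ : ℝ) (hδ : δ = 1 ∨ δ = -1) (φ : ℝ) (hφ₁ : 0 < φ) (hφ₂ : φ ≤ Real.pi / 2) :
    (∀ s0 s : ℂ, 1/100 < s0.re → s.re < 4 → 0 < 2 * s.re - s0.re - 1/100 →
      Integrable (fun p : ℝ × ℝ =>
        mellinT (Hflat H) (s - (15 + p.1 * Complex.I) - 1/2) *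
          GkerPhi α δ φ (15 + p.1 * Complex.I) (1/100 + p.2 * Complex.I) s0 s)) ∧
    DifferentiableOn ℂ (fun p : ℂ × ℂ => FtransPhi α δ φ H p.1 p.2)
      {p : ℂ × ℂ | 1/100 < p.1.re ∧ p.2.re < 4 ∧ 0 < 2 * p.2.re - p.1.re - 1/100} := by
  have hδ' : |δ| ≤ 1 := by rcases hδ with rfl | rfl <;> simp
  have hφ' : |φ| ≤ Real.pi / 2 := by rwa [abs_of_pos hφ₁]
  have hint : ∀ x ∈ transformDomain, Integrable (transformIntegrand α δ φ H x) := by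
    intro x hx
    obtain ⟨V, hV, b, hb, hle⟩ :=
      exists_integrable_bound_transformIntegrand hη hH hre hδ' hφ' hx
    exact hb.mono' (continuous_transformIntegrand hη hH hre hx).aestronglyMeasurable
      (ae_of_all _ (hle x (mem_of_mem_nhds hV)))
  refine ⟨fun s0 s h1 h2 h3 => hint (s0, s) ⟨h1, h2, h3⟩, ?_⟩
  have hdiff := differentiableOn_integral_of_locally_dominated (μ := volume)
    isOpen_transformDomain
    (fun x hx => (continuous_transformIntegrand (δ := δ) (φ := φ)
      hη hH hre hx).aestronglyMeasurable)
    (differentiableOn_transformIntegrand hη hH hre)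
    fun x hx => exists_integrable_bound_transformIntegrand hη hH hre hδ' hφ' hx
  refine (hdiff.const_mul ((1 / (2 * (Real.pi : ℂ))) ^ 2)).congr fun x hx => ?_
  rw [FtransPhi, Measure.volume_eq_prod, integral_prod _ (hint x hx)]
  rfl
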